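/- Let 0 < p, θ ≤ ∞ and let Ω satisfy conditions (I)–(III) and conditions (a),(b) with exponents μ > 0 and ρ < min(r, r − 1 + 1/p). Then there is a constant C such that for every k ∈ ℤ_+^d and every g ∈ Σ_r^d(k): ‖g‖_{B^Ω_{p,θ}} ≤ C ‖g‖_p / Ω(2^{-k}). -/

import Mathlib

open MeasureTheory Filter
open scoped ENNReal Classical BigOperators

noncomputable section

namespace SparseGrid

/-- The unit cube `[0,1]^d`. -/
def cube (d : ℕ) : Set (Fin d → ℝ) := Set.univ.pi fun _ => Set.Icc (0:ℝ) 1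

/-- The `L_p` quasi-norm on the unit cube. -/
def lpQ (d : ℕ) (p : ℝ≥0∞) (f : (Fin d → ℝ) → ℝ) : ℝ≥0∞ :=
  eLpNorm f p (volume.restrict (cube d))

/-- Univariate `r`-th difference applied in coordinate `i`. -/
def diffC (d r : ℕ) (i : Fin d) (h : ℝ) (f : (Fin d → ℝ) → ℝ) (x : Fin d → ℝ) : ℝ :=
  ∑ j ∈ Finset.range (r + 1),
    (-1 : ℝ) ^ (r - j) * (r.choose j : ℝ) * f (Function.update x i (x i + j * h))

/-- The mixed `(r,e)`-th difference operator. -/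
def mixDiff (d r : ℕ) (e : Finset (Fin d)) (h : Fin d → ℝ) (f : (Fin d → ℝ) → ℝ) :
    (Fin d → ℝ) → ℝ :=
  e.toList.foldr (fun i g => diffC d r i (h i) g) f

/-- The set `𝕀^d(h,e)`. -/
def cubeHE (d r : ℕ) (h : Fin d → ℝ) (e : Finset (Fin d)) : Set (Fin d → ℝ) :=
  {x | x ∈ cube d ∧ ∀ i ∈ e, x i + r * h i ∈ Set.Icc (0:ℝ) 1}

/-- The mixed `(r,e)`-th modulus of smoothness in `L_p`. -/
def modulus (d r : ℕ) (e : Finset (Fin d)) (p : ℝ≥0∞) (f : (Fin d → ℝ) → ℝ)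
    (t : Fin d → ℝ) : ℝ≥0∞ :=
  ⨆ (h : Fin d → ℝ) (_ : ∀ i ∈ e, |h i| < t i),
    eLpNorm (mixDiff d r e h f) p (volume.restrict (cubeHE d r h e))

/-- `t^e`. -/
def tE (d : ℕ) (e : Finset (Fin d)) (t : Fin d → ℝ) : Fin d → ℝ :=
  fun i => if i ∈ e then t i else 1

/-- The Besov-type quasi-seminorm `|f|_{B^Ω_{p,θ}(e)}`. -/
def besovSemi (d r : ℕ) (p θ : ℝ≥0∞) (Ω : (Fin d → ℝ) → ℝ) (e : Finset (Fin d))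
    (f : (Fin d → ℝ) → ℝ) : ℝ≥0∞ :=
  if θ = ∞ then
    ⨆ (t : Fin d → ℝ) (_ : t ∈ cube d),
      modulus d r e p f t / ENNReal.ofReal (Ω (tE d e t))
  else
    (∫⁻ t in cube d,
        (modulus d r e p f t / ENNReal.ofReal (Ω (tE d e t))) ^ θ.toReal *
          ∏ i ∈ e, ENNReal.ofReal (t i)⁻¹) ^ (1 / θ.toReal)

/-- The Besov-type quasi-norm `‖f‖_{B^Ω_{p,θ}}`. -/
def besovNorm (d r : ℕ) (p θ : ℝ≥0∞) (Ω : (Fin d → ℝ) → ℝ)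
    (f : (Fin d → ℝ) → ℝ) : ℝ≥0∞ :=
  ∑ e : Finset (Fin d), besovSemi d r p θ Ω e f

/-- The dyadic vector `2^{-k}`. -/
def dyadic (d : ℕ) (k : Fin d → ℕ) : Fin d → ℝ := fun i => ((2:ℝ) ^ (k i))⁻¹

/-- `|k|_1`. -/
def knorm1 (d : ℕ) (k : Fin d → ℕ) : ℝ := ∑ i, (k i : ℝ)

/-- `|k|_∞`. -/
def knormInf (d : ℕ) (k : Fin d → ℕ) : ℝ := ((Finset.univ.sup k : ℕ) : ℝ)

/-- `Ω(t) = ∏ t_i^{a_i}` (mixed smoothness `a`). -/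
def OmegaA (d : ℕ) (a : Fin d → ℝ) (t : Fin d → ℝ) : ℝ := ∏ i, t i ^ a i

/-- `Ω(t) = ∏ t_i^α · inf_j t_j^β` (β ≥ 0), resp. `∏ t_i^α · sup_j t_j^β` (β < 0). -/
def OmegaAB (d : ℕ) (α β : ℝ) (t : Fin d → ℝ) : ℝ :=
  if 0 ≤ β then (∏ i, t i ^ α) * ⨅ j, t j ^ β
  else (∏ i, t i ^ α) * ⨆ j, t j ^ β

/-- The centered cardinal B-spline of order `r` (`r`-fold convolution of the
indicator of `[-1/2,1/2]`). -/
def centerB : ℕ → ℝ → ℝ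
  | 0, _ => 0
  | 1, x => if -(1/2 : ℝ) ≤ x ∧ x < 1/2 then 1 else 0
  | (n + 2), x => ∫ y in (-(1/2) : ℝ)..(1/2 : ℝ), centerB (n + 1) (x - y)

/-- The `d`-variate B-spline `M^{(r)}_{k,s}` (integer translated dilations if `r` is even,
half-integer if `r` is odd). -/
def Mrks (d r : ℕ) (k : Fin d → ℕ) (s : Fin d → ℤ) (x : Fin d → ℝ) : ℝ :=
  ∏ i, centerB r ((2:ℝ) ^ (k i) * x i - (if Even r then (s i : ℝ) else (s i : ℝ) / 2))

/-- `J_r^d(k)`: the set of `s` for which `M^{(r)}_{k,s}` does not vanish identically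
on the cube. -/
def Jrd (d r : ℕ) (k : Fin d → ℕ) : Set (Fin d → ℤ) :=
  {s | ¬ ∀ x ∈ cube d, Mrks d r k s x = 0}

/-- `Σ_r^d(k)`: the span of the B-splines `M^{(r)}_{k,s}`, `s ∈ J_r^d(k)`. -/
def SigmaRd (d r : ℕ) (k : Fin d → ℕ) : Submodule ℝ ((Fin d → ℝ) → ℝ) :=
  Submodule.span ℝ (Mrks d r k '' Jrd d r k)

/-- The quasi-interpolation operator `Q(f,x) = ∑_s Λ(f,s) M(x-s)` on `ℝ`. -/
def Qop (r m : ℕ) (lam : ℤ → ℝ) (f : ℝ → ℝ) (x : ℝ) : ℝ :=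
  ∑' s : ℤ,
    (∑ j ∈ Finset.Icc (-(m:ℤ)) (m:ℤ), lam j * f ((s - j : ℤ) : ℝ)) * centerB r (x - (s:ℝ))

/-- `Q` is a quasi-interpolation operator: `lam` is even, supported in `|j| ≤ m`,
`m ≥ r/2 - 1`, and `Q` reproduces polynomials of degree at most `r-1`. -/
def QuasiInterp (r m : ℕ) (lam : ℤ → ℝ) : Prop :=
  (∀ j : ℤ, lam (-j) = lam j) ∧
  (∀ j : ℤ, (m : ℤ) < |j| → lam j = 0) ∧
  ((r : ℝ) / 2 - 1 ≤ m) ∧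
  (∀ P : Polynomial ℝ, P.natDegree < r →
    ∀ x : ℝ, Qop r m lam (fun y => Polynomial.eval y P) x = Polynomial.eval x P)

/-- The Lagrange extension `f̄_k` of a function on `[0,1]` to `ℝ`. -/
def extendF (r k : ℕ) (f : ℝ → ℝ) (x : ℝ) : ℝ :=
  if x < 0 then
    Polynomial.eval x (Lagrange.interpolate (Finset.range r) (fun j => (j : ℝ) / 2 ^ k)
      (fun j => f ((j : ℝ) / 2 ^ k)))
  else if x ≤ 1 then f x
  else
    Polynomial.eval x (Lagrange.interpolate (Finset.range r)
      (fun j => ((2 ^ k : ℝ) - r + 1 + j) / 2 ^ k)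
      (fun j => f (((2 ^ k : ℝ) - r + 1 + j) / 2 ^ k)))

/-- The coefficient functional `a_{k,s}(f)`. -/
def aks (r m : ℕ) (lam : ℤ → ℝ) (k : ℕ) (f : ℝ → ℝ) (s : ℤ) : ℝ :=
  ∑ j ∈ Finset.Icc (-(m:ℤ)) (m:ℤ), lam j * extendF r k f (((s - j : ℤ) : ℝ) / 2 ^ k)

/-- The boundary-corrected dyadic quasi-interpolation operator `Q_k` on `[0,1]`. -/
def Qb (r m : ℕ) (lam : ℤ → ℝ) (k : ℕ) (f : ℝ → ℝ) (x : ℝ) : ℝ :=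
  ∑' s : ℤ,
    if -(r : ℤ) < 2 * s ∧ 2 * s < 2 ^ (k + 1) + r then
      aks r m lam k f s * centerB r ((2:ℝ) ^ k * x - (s : ℝ))
    else 0

/-- `Q_k` applied in coordinate `i`. -/
def QbC (d r m : ℕ) (lam : ℤ → ℝ) (i : Fin d) (k : ℕ) (f : (Fin d → ℝ) → ℝ)
    (x : Fin d → ℝ) : ℝ :=
  Qb r m lam k (fun y => f (Function.update x i y)) (x i)

/-- `Q_k - Q_{k-1}` applied in coordinate `i` (with `Q_{-1} = 0`). -/
def qbDiffC (d r m : ℕ) (lam : ℤ → ℝ) (i : Fin d) (k : ℕ) (f : (Fin d → ℝ) → ℝ)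
    (x : Fin d → ℝ) : ℝ :=
  QbC d r m lam i k f x - (if k = 0 then 0 else QbC d r m lam i (k - 1) f x)

/-- The mixed operator `Q_k = ∏_i Q_{k_i}`. -/
def QMix (d r m : ℕ) (lam : ℤ → ℝ) (k : Fin d → ℕ) (f : (Fin d → ℝ) → ℝ) :
    (Fin d → ℝ) → ℝ :=
  (List.finRange d).foldr (fun i g => QbC d r m lam i (k i) g) f

/-- The mixed dyadic component `q_k = ∏_i (Q_{k_i} - Q_{k_i - 1})`. -/
def qMix (d r m : ℕ) (lam : ℤ → ℝ) (k : Fin d → ℕ) (f : (Fin d → ℝ) → ℝ) :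
    (Fin d → ℝ) → ℝ :=
  (List.finRange d).foldr (fun i g => qbDiffC d r m lam i (k i) g) f

/-- `R_Δ(f) = ∑_{k ∈ Δ} q_k(f)`. -/
def RDelta (d r m : ℕ) (lam : ℤ → ℝ) (Δ : Set (Fin d → ℕ)) (f : (Fin d → ℝ) → ℝ)
    (x : Fin d → ℝ) : ℝ :=
  ∑' k : Δ, qMix d r m lam k f x

/-- Convergence of the series `∑_{k ∈ ℤ_+^d} F_k` to `g` in the norm of `L_∞(𝕀^d)`. -/
def ConvLinf (d : ℕ) (F : (Fin d → ℕ) → (Fin d → ℝ) → ℝ) (g : (Fin d → ℝ) → ℝ) : Prop :=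
  Tendsto (fun Δ : Finset (Fin d → ℕ) =>
      eLpNorm (fun x => g x - ∑ k ∈ Δ, F k x) ∞ (volume.restrict (cube d)))
    atTop (nhds 0)

/-- The quantity `B_4({g_k}) = (∑_k {‖g_k‖_p / Ω(2^{-k})}^θ)^{1/θ}`. -/
def B4seq (d : ℕ) (p θ : ℝ≥0∞) (Ω : (Fin d → ℝ) → ℝ)
    (gk : (Fin d → ℕ) → (Fin d → ℝ) → ℝ) : ℝ≥0∞ :=
  if θ = ∞ then ⨆ k : Fin d → ℕ, lpQ d p (gk k) / ENNReal.ofReal (Ω (dyadic d k))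
  else (∑' k : Fin d → ℕ,
      (lpQ d p (gk k) / ENNReal.ofReal (Ω (dyadic d k))) ^ θ.toReal) ^ (1 / θ.toReal)

/-- The quantity `B_2(f) = (∑_k {‖q_k(f)‖_p / Ω(2^{-k})}^θ)^{1/θ}`. -/
def B2 (d r m : ℕ) (lam : ℤ → ℝ) (p θ : ℝ≥0∞) (Ω : (Fin d → ℝ) → ℝ)
    (f : (Fin d → ℝ) → ℝ) : ℝ≥0∞ :=
  B4seq d p θ Ω (fun k => qMix d r m lam k f)

/-- The quasi-norm `‖f‖_{B^ψ_{p,θ}} = (∑_k (2^{ψ(k)} ‖q_k f‖_p)^θ)^{1/θ}`. -/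
def bpsiNorm (d r m : ℕ) (lam : ℤ → ℝ) (ψ : (Fin d → ℕ) → ℝ) (p θ : ℝ≥0∞)
    (f : (Fin d → ℝ) → ℝ) : ℝ≥0∞ :=
  if θ = ∞ then
    ⨆ k : Fin d → ℕ, ENNReal.ofReal ((2:ℝ) ^ (ψ k)) * lpQ d p (qMix d r m lam k f)
  else (∑' k : Fin d → ℕ,
      (ENNReal.ofReal ((2:ℝ) ^ (ψ k)) * lpQ d p (qMix d r m lam k f)) ^ θ.toReal) ^
    (1 / θ.toReal)

/-- `I^d(k) = {s ∈ ℤ_+^d : 0 ≤ s_i ≤ 2^{k_i}}`. -/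
def IdkF (d : ℕ) (k : Fin d → ℕ) : Finset (Fin d → ℕ) :=
  Fintype.piFinset fun i => Finset.range (2 ^ (k i) + 1)

/-- The dyadic grid point `2^{-k} s`. -/
def gridPt (d : ℕ) (k : Fin d → ℕ) (s : Fin d → ℕ) : Fin d → ℝ :=
  fun i => (s i : ℝ) / 2 ^ (k i)

/-- `|G(Δ)| = ∑_{k ∈ Δ} ∏_j (2^{k_j} + 1)`, counted with multiplicity. -/
def gridSizeE (d : ℕ) (Δ : Set (Fin d → ℕ)) : ℝ≥0∞ :=
  ∑' k : Δ, ∏ i, ((2:ℝ≥0∞) ^ ((k : Fin d → ℕ) i) + 1)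

/-- `∑_{k ∈ Δ} 2^{|k|_1}`. -/
def sum2E (d : ℕ) (Δ : Set (Fin d → ℕ)) : ℝ≥0∞ :=
  ∑' k : Δ, (2:ℝ≥0∞) ^ (∑ i, (k : Fin d → ℕ) i)

/-- The set `A` of triples `(p,θ,q)`. -/
def tripleA (p θ q : ℝ≥0∞) : Prop :=
  (q ≤ p ∧ θ ≤ min q 1) ∨ (p < q ∧ q < ∞ ∧ θ ≤ q) ∨ (p < q ∧ q = ∞ ∧ θ ≤ 1)

/-- `(1/p - 1/q)_+`. -/
def rhoPQ (p q : ℝ≥0∞) : ℝ := max 0 (p⁻¹.toReal - q⁻¹.toReal)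

/-- The sparse index set `Δ(ξ)` for the classes `U^{α,β}_{p,θ}`. -/
def DeltaAB (d : ℕ) (p θ q : ℝ≥0∞) (α β ε : ℝ) (ξ : ℝ) : Set (Fin d → ℕ) :=
  if tripleA p θ q then
    {k | (α - rhoPQ p q) * knorm1 d k + β * knormInf d k ≤ ξ}
  else if 0 < β then
    {k | (α - rhoPQ p q + ε / d) * knorm1 d k + (β - ε) * knormInf d k ≤ ξ}
  else
    {k | (α - rhoPQ p q - ε) * knorm1 d k + (β + ε) * knormInf d k ≤ ξ}

/-- The sparse index set `Δ'(ξ)` for the classes `U^a_{p,θ}`. -/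
def DeltaA (d : ℕ) (p θ q : ℝ≥0∞) (a : Fin d → ℝ) (ε : ℝ) (ξ : ℝ) : Set (Fin d → ℕ) :=
  if tripleA p θ q then
    {k | (∑ i, a i * (k i : ℝ)) - rhoPQ p q * knorm1 d k ≤ ξ}
  else
    {k | (∑ i : Fin d, (if i.val = 0 then a i else a i - ε) * (k i : ℝ))
          - rhoPQ p q * knorm1 d k ≤ ξ}

/-- The sparse index set `Δ''(ξ)` for recovery in the energy norm. -/
def DeltaG (d : ℕ) (p q θ τ : ℝ≥0∞) (α β γ ε : ℝ) (ξ : ℝ) : Set (Fin d → ℕ) :=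
  if θ ≤ min τ 1 then
    {k | (α - rhoPQ p q) * knorm1 d k - (γ - β) * knormInf d k ≤ ξ}
  else if γ < β then
    {k | (α - rhoPQ p q + ε / d) * knorm1 d k - (γ - β - ε) * knormInf d k ≤ ξ}
  else
    {k | (α - rhoPQ p q - ε) * knorm1 d k - (γ - β + ε) * knormInf d k ≤ ξ}

/-- The unit ball of `B^Ω_{p,θ}` (of continuous functions). -/
def Uball (d r : ℕ) (p θ : ℝ≥0∞) (Ω : (Fin d → ℝ) → ℝ) : Set ((Fin d → ℝ) → ℝ) :=
  {f | ContinuousOn f (cube d) ∧ besovNorm d r p θ Ω f ≤ 1}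

/-- The quantity `r_n(W, ·)` of optimal linear sampling recovery. -/
def rW (d n : ℕ) (W : Set ((Fin d → ℝ) → ℝ)) (nrm : ((Fin d → ℝ) → ℝ) → ℝ≥0∞) : ℝ≥0∞ :=
  ⨅ (X : Fin n → Fin d → ℝ) (_ : ∀ j, X j ∈ cube d) (Φ : Fin n → (Fin d → ℝ) → ℝ),
    ⨆ f ∈ W, nrm (fun x => f x - ∑ j, f (X j) * Φ j x)

/-- The quantity `ϱ_n(W, ·)` of optimal (nonlinear) sampling recovery. -/
def rhoW (d n : ℕ) (W : Set ((Fin d → ℝ) → ℝ)) (nrm : ((Fin d → ℝ) → ℝ) → ℝ≥0∞) : ℝ≥0∞ :=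
  ⨅ (X : Fin n → Fin d → ℝ) (_ : ∀ j, X j ∈ cube d) (P : (Fin n → ℝ) → (Fin d → ℝ) → ℝ),
    ⨆ f ∈ W, nrm (fun x => f x - P (fun j => f (X j)) x)

/-- The quantity `i_n(W)` of optimal cubature. -/
def iW (d n : ℕ) (W : Set ((Fin d → ℝ) → ℝ)) : ℝ≥0∞ :=
  ⨅ (X : Fin n → Fin d → ℝ) (_ : ∀ j, X j ∈ cube d) (Λ : Fin n → ℝ),
    ⨆ f ∈ W, ENNReal.ofReal |(∫ x in cube d, f x) - ∑ j, Λ j * f (X j)|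

/-- `R_Δ` is a linear sampling algorithm on the grid `G(Δ)`. -/
def IsSamplingAlg (d r m : ℕ) (lam : ℤ → ℝ) (Δ : Set (Fin d → ℕ)) : Prop :=
  ∃ ψ : (Fin d → ℕ) → (Fin d → ℕ) → (Fin d → ℝ) → ℝ,
    ∀ f : (Fin d → ℝ) → ℝ, ContinuousOn f (cube d) → ∀ x ∈ cube d,
      RDelta d r m lam Δ f x =
        ∑' k : Δ, ∑ s ∈ IdkF d (k : Fin d → ℕ), f (gridPt d (k : Fin d → ℕ) s) * ψ k s x

/-- The discrete quasi-norm `B_1(f)`. -/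
def B1 (d r : ℕ) (p θ : ℝ≥0∞) (Ω : (Fin d → ℝ) → ℝ) (f : (Fin d → ℝ) → ℝ) : ℝ≥0∞ :=
  ∑ e : Finset (Fin d),
    if θ = ∞ then
      ⨆ (k : Fin d → ℕ) (_ : ∀ i ∉ e, k i = 0),
        modulus d r e p f (dyadic d k) / ENNReal.ofReal (Ω (dyadic d k))
    else
      (∑' k : Fin d → ℕ,
          if ∀ i ∉ e, k i = 0 then
            (modulus d r e p f (dyadic d k) / ENNReal.ofReal (Ω (dyadic d k))) ^ θ.toReal
          else 0) ^ (1 / θ.toReal)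

end SparseGrid

namespace SparseGrid

/-- Truncated power. -/
def tp (m : ℕ) (x : ℝ) : ℝ := if 0 ≤ x then x ^ m else 0

lemma tp_mono (m : ℕ) : Monotone (tp m) := by
  intro a b hab
  unfold tp
  split_ifs with h1 h2
  · exact pow_le_pow_left₀ h1 hab m
  · exact absurd (h1.trans hab) h2
  · positivity
  · exact le_rfl

lemma tp_intervalIntegrable (m : ℕ) (a b : ℝ) : IntervalIntegrable (tp m) volume a b :=
  (tp_mono m).intervalIntegrable

lemma tp_hasDerivAt (m : ℕ) {x : ℝ} (hx : x ≠ 0) :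
    HasDerivAt (tp (m + 1)) ((m + 1 : ℝ) * tp m x) x := by
  rcases lt_or_gt_of_ne hx with h | h
  · have h0 : (m + 1 : ℝ) * tp m x = 0 := by simp [tp, not_le.2 h]
    rw [h0]
    apply (hasDerivAt_const x (0:ℝ)).congr_of_eventuallyEq
    filter_upwards [Iio_mem_nhds h] with y hy
    simp [tp, not_le.2 (Set.mem_Iio.1 hy)]
  · have h0 : (m + 1 : ℝ) * tp m x = ((m + 1 : ℕ) : ℝ) * x ^ m := by simp [tp, h.le]
    rw [h0]
    apply (hasDerivAt_pow (m + 1) x).congr_of_eventuallyEq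
    filter_upwards [Ioi_mem_nhds h] with y hy
    simp [tp, (Set.mem_Ioi.1 hy).le]

lemma tp_continuous (m : ℕ) : Continuous (tp (m + 1)) := by
  unfold tp
  apply Continuous.if_le (by fun_prop) (by fun_prop) (by fun_prop) (by fun_prop)
  intro x hx
  simp [← hx]

lemma tp_integral (m : ℕ) (a b : ℝ) :
    ∫ y in a..b, tp m y = (tp (m + 1) b - tp (m + 1) a) / (m + 1) := by
  have h := integral_eq_of_hasDerivAt_off_countable (a := a) (b := b) (tp (m+1))
    (fun x => (m + 1 : ℝ) * tp m x)
    (s := {0}) (Set.countable_singleton _) (tp_continuous m).continuousOn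
    (fun x hx => tp_hasDerivAt m (by simpa using hx.2))
    ((tp_intervalIntegrable m a b).const_mul _)
  rw [intervalIntegral.integral_const_mul] at h
  rw [← h]
  field_simp

/-- Span of truncated powers. -/
def TS (m : ℕ) : Submodule ℝ (ℝ → ℝ) :=
  Submodule.span ℝ (Set.range fun (j : ℤ) (x : ℝ) => tp m (x + ((m:ℝ) + 1) / 2 - j))

lemma TS_step (m : ℕ) (f : ℝ → ℝ) (hf : f ∈ TS m) :
    (∀ a b, IntervalIntegrable f volume a b) ∧
    (fun x => ∫ y in (-(1/2) : ℝ)..(1/2 : ℝ), f (x - y)) ∈ TS (m + 1) := by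
  have key : ∀ g : ℝ → ℝ, (∀ a b, IntervalIntegrable g volume a b) → ∀ x,
      IntervalIntegrable (fun y => g (x - y)) volume (-(1/2)) (1/2) := by
    intro g hg x
    have := (hg (x + 1/2) (x - 1/2)).comp_sub_left x
    simpa using this
  unfold TS at hf
  induction hf using Submodule.span_induction with
  | mem f hf =>
    obtain ⟨j, rfl⟩ := hf
    refine ⟨fun a b => Monotone.intervalIntegrable fun a b hab => tp_mono m (by linarith), ?_⟩
    have : (fun x : ℝ => ∫ y in (-(1/2) : ℝ)..(1/2 : ℝ),
        tp m (x - y + ((m:ℝ) + 1) / 2 - j)) =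
        (1 / ((m:ℝ) + 1)) • ((fun x : ℝ => tp (m+1) (x + (((m+1 : ℕ):ℝ) + 1) / 2 - (j:ℤ))) -
          (fun x : ℝ => tp (m+1) (x + (((m+1 : ℕ):ℝ) + 1) / 2 - ((j + 1 : ℤ) : ℝ)))) := by
      funext x
      have e1 : ∀ y : ℝ, x - y + ((m:ℝ) + 1) / 2 - j = (x + ((m:ℝ) + 1) / 2 - j) - y := by
        intro y; ring
      simp_rw [e1]
      rw [intervalIntegral.integral_comp_sub_left (fun z => tp m z), tp_integral]
      simp only [Pi.smul_apply, Pi.sub_apply, smul_eq_mul]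
      have e2 : x + ((m:ℝ) + 1) / 2 - j - -(1/2) = x + (((m+1 : ℕ):ℝ) + 1) / 2 - j := by
        push_cast; ring
      have e3 : x + ((m:ℝ) + 1) / 2 - j - 1/2 =
          x + (((m+1 : ℕ):ℝ) + 1) / 2 - ((j + 1 : ℤ) : ℝ) := by
        push_cast; ring
      rw [e2, e3]
      ring
    rw [this]
    refine Submodule.smul_mem _ _ (Submodule.sub_mem _ ?_ ?_)
    · exact Submodule.subset_span ⟨j, rfl⟩
    · exact Submodule.subset_span ⟨j + 1, rfl⟩
  | zero => exact ⟨fun a b => intervalIntegrable_const, by simp; exact Submodule.zero_mem (TS (m+1))⟩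
  | add f g _ _ hf hg =>
    refine ⟨fun a b => (hf.1 a b).add (hg.1 a b), ?_⟩
    convert Submodule.add_mem _ hf.2 hg.2 using 1
    funext x
    exact intervalIntegral.integral_add (key f hf.1 x) (key g hg.1 x)
  | smul c f _ hf =>
    refine ⟨fun a b => (hf.1 a b).smul c, ?_⟩
    convert Submodule.smul_mem _ c hf.2 using 1
    funext x
    exact intervalIntegral.integral_const_mul _ _

lemma centerB_mem (m : ℕ) : centerB (m + 1) ∈ TS m := by
  induction m with
  | zero =>
    have : centerB (0 + 1) = (fun x : ℝ => tp 0 (x + (((0:ℕ):ℝ) + 1) / 2 - (0 : ℤ))) -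
          (fun x : ℝ => tp 0 (x + (((0 : ℕ):ℝ) + 1) / 2 - ((1 : ℤ) : ℝ))) := by
      funext x
      simp only [centerB, tp, pow_zero, Pi.sub_apply]
      norm_num
      split_ifs <;> first | (exfalso; grind) | norm_num
    rw [this]
    exact Submodule.sub_mem _ (Submodule.subset_span ⟨0, rfl⟩) (Submodule.subset_span ⟨1, rfl⟩)
  | succ n ih => exact (TS_step n _ ih).2

lemma TS_measurable (m : ℕ) (f : ℝ → ℝ) (hf : f ∈ TS m) : Measurable f := by
  unfold TS at hf
  induction hf using Submodule.span_induction with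
  | mem f hf =>
    obtain ⟨j, rfl⟩ := hf
    exact (tp_mono m).measurable.comp (by fun_prop)
  | zero => exact measurable_const
  | add f g _ _ hf hg => exact hf.add hg
  | smul c f _ hf => exact hf.const_smul c

/-- Splines of order `m+1` with mesh `1/N`. -/
def Spl (m : ℕ) (N : ℝ) : Submodule ℝ (ℝ → ℝ) where
  carrier := {u | ∀ n : ℤ, ∃ (P : Polynomial ℝ) (c : ℝ), P.natDegree ≤ m ∧
    ∀ x : ℝ, (n:ℝ) - 1 ≤ N * x → N * x < n + 1 → u x = P.eval x + c * tp m (N * x - n)}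
  zero_mem' := fun n => ⟨0, 0, by simp, by simp⟩
  add_mem' := by
    intro u v hu hv n
    obtain ⟨P, c, hP, h⟩ := hu n
    obtain ⟨Q, c', hQ, h'⟩ := hv n
    refine ⟨P + Q, c + c', (Polynomial.natDegree_add_le _ _).trans (max_le hP hQ), ?_⟩
    intro x h1 h2
    simp only [Pi.add_apply, Polynomial.eval_add]
    rw [h x h1 h2, h' x h1 h2]; ring
  smul_mem' := by
    intro a u hu n
    obtain ⟨P, c, hP, h⟩ := hu n
    refine ⟨a • P, a * c, (Polynomial.natDegree_smul_le _ _).trans hP, ?_⟩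
    intro x h1 h2
    simp only [Pi.smul_apply, Polynomial.eval_smul, smul_eq_mul]
    rw [h x h1 h2]; ring

lemma tp_mem_Spl (m : ℕ) (N : ℝ) (a : ℤ) : (fun x => tp m (N * x - a)) ∈ Spl m N := by
  intro n
  rcases lt_trichotomy a n with h | h | h
  · refine ⟨(Polynomial.C N * Polynomial.X - Polynomial.C (a:ℝ)) ^ m, 0, ?_, ?_⟩
    · compute_degree
    · intro x h1 h2
      have : (a:ℝ) ≤ n - 1 := by exact_mod_cast Int.le_sub_one_of_lt h
      have h3 : 0 ≤ N * x - a := by linarith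
      simp [tp, if_pos h3, -sub_nonneg]
  · subst h
    exact ⟨0, 1, by simp, by simp⟩
  · refine ⟨0, 0, by simp, ?_⟩
    intro x h1 h2
    have : (n:ℝ) + 1 ≤ a := by exact_mod_cast h
    have h3 : ¬ 0 ≤ N * x - a := by linarith
    simp only [tp, if_neg h3]; simp

lemma scaled_mem_Spl (m k : ℕ) (s : ℤ) (f : ℝ → ℝ) (hf : f ∈ TS m) :
    (fun y => f ((2:ℝ) ^ k * y - (s:ℝ) / 2)) ∈ Spl m (2 * 2 ^ k) := by
  unfold TS at hf
  induction hf using Submodule.span_induction with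
  | mem f hf =>
    obtain ⟨j, rfl⟩ := hf
    have : (fun y : ℝ => tp m ((2:ℝ) ^ k * y - (s:ℝ) / 2 + ((m:ℝ) + 1) / 2 - j)) =
        ((1/2:ℝ) ^ m) • (fun y : ℝ => tp m (2 * 2 ^ k * y - ((s + 2 * j - m - 1 : ℤ):ℝ))) := by
      funext y
      have e : (2:ℝ) ^ k * y - (s:ℝ) / 2 + ((m:ℝ) + 1) / 2 - j =
        (1/2) * (2 * 2 ^ k * y - ((s + 2 * j - m - 1 : ℤ):ℝ)) := by push_cast; ring
      rw [e]
      simp only [Pi.smul_apply, smul_eq_mul, tp]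
      by_cases h0 : 0 ≤ (2 * 2 ^ k * y - ((s + 2 * j - m - 1 : ℤ):ℝ))
      · rw [if_pos h0, if_pos (by positivity), mul_pow]
      · rw [if_neg h0, if_neg (by linarith), mul_zero]
    show (fun y : ℝ => tp m ((2:ℝ) ^ k * y - (s:ℝ) / 2 + ((m:ℝ) + 1) / 2 - j)) ∈ _
    rw [this]
    exact Submodule.smul_mem _ _ (tp_mem_Spl _ _ _)
  | zero => exact Submodule.zero_mem _
  | add f g _ _ hf hg => exact Submodule.add_mem _ hf hg
  | smul c f _ hf => exact Submodule.smul_mem _ c hf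

/-- univariate difference -/
def D (r : ℕ) (h : ℝ) (u : ℝ → ℝ) (x : ℝ) : ℝ :=
  ∑ j ∈ Finset.range (r + 1), (-1 : ℝ) ^ (r - j) * (r.choose j : ℝ) * u (x + j * h)

lemma D_poly (m : ℕ) (h : ℝ) (P : Polynomial ℝ) (hP : P.natDegree ≤ m) (x : ℝ) :
    D (m + 1) h (fun y => P.eval y) x = 0 := by
  set Q := P.comp (Polynomial.C x + Polynomial.C h * Polynomial.X) with hQ
  have hd : Q.natDegree < m + 1 := by
    rw [hQ, Polynomial.natDegree_comp]
    have : (Polynomial.C x + Polynomial.C h * Polynomial.X).natDegree ≤ 1 := by compute_degree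
    nlinarith
  have := congrFun (Polynomial.fwdDiff_iter_eq_zero_of_degree_lt hd) 0
  rw [fwdDiff_iter_eq_sum_shift] at this
  simp only [hQ, Pi.zero_apply] at this
  rw [← this]
  unfold D
  refine Finset.sum_congr rfl fun j _ => ?_
  simp [mul_comm h]

end SparseGrid

namespace SparseGrid

lemma D_enorm_le (r : ℕ) (h : ℝ) (u : ℝ → ℝ) (x : ℝ) (B : ℝ≥0∞)
    (hB : ∀ j ∈ Finset.range (r + 1), ‖u (x + j * h)‖ₑ ≤ B) :
    ‖D r h u x‖ₑ ≤ 2 ^ r * B := by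
  unfold D
  calc ‖∑ j ∈ Finset.range (r + 1), (-1 : ℝ) ^ (r - j) * (r.choose j : ℝ) * u (x + j * h)‖ₑ
      ≤ ∑ j ∈ Finset.range (r + 1),
        ‖(-1 : ℝ) ^ (r - j) * (r.choose j : ℝ) * u (x + j * h)‖ₑ := enorm_sum_le _ _
    _ ≤ ∑ j ∈ Finset.range (r + 1), (r.choose j : ℝ≥0∞) * B := by
        refine Finset.sum_le_sum fun j hj => ?_
        rw [enorm_mul, enorm_mul, enorm_pow]
        have h1 : ‖(-1:ℝ)‖ₑ = 1 := by simp
        have h2 : ‖(r.choose j : ℝ)‖ₑ = (r.choose j : ℝ≥0∞) := by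
          rw [Real.enorm_of_nonneg (by positivity), ENNReal.ofReal_natCast]
        rw [h1, one_pow, one_mul, h2]
        exact mul_le_mul_right (hB j hj) _
    _ = 2 ^ r * B := by
        rw [← Finset.sum_mul]
        congr 1
        have := Nat.sum_range_choose r
        exact_mod_cast this

lemma D_measurable (r : ℕ) (h : ℝ) (u : ℝ → ℝ) (hu : Measurable u) : Measurable (D r h u) := by
  unfold D
  fun_prop

lemma D_pow_le (r : ℕ) (h : ℝ) (u : ℝ → ℝ) (x : ℝ) (q : ℝ) (hq : 0 < q) :
    ‖D r h u x‖ₑ ^ q ≤ (2 ^ r) ^ q * ∑ j ∈ Finset.range (r + 1), ‖u (x + j * h)‖ₑ ^ q := by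
  have h1 : ‖D r h u x‖ₑ ≤ 2 ^ r * (∑ j ∈ Finset.range (r + 1), ‖u (x + j * h)‖ₑ ^ q) ^ (1/q) := by
    apply D_enorm_le
    intro j hj
    rw [one_div, ENNReal.le_rpow_inv_iff hq]
    exact Finset.single_le_sum (f := fun j : ℕ => ‖u (x + j * h)‖ₑ ^ q) (fun _ _ => zero_le) hj
  calc _ ≤ (2 ^ r * (∑ j ∈ Finset.range (r + 1), ‖u (x + j * h)‖ₑ ^ q) ^ (1/q)) ^ q :=
        ENNReal.rpow_le_rpow h1 hq.le
    _ = _ := by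
        rw [ENNReal.mul_rpow_of_nonneg _ _ hq.le, ← ENNReal.rpow_mul, one_div_mul_cancel hq.ne',
          ENNReal.rpow_one]

lemma shift_int (r : ℕ) (h : ℝ) (u : ℝ → ℝ) (hu : Measurable u) (q : ℝ) (hq : 0 < q)
    (A B : Set ℝ) (hA : MeasurableSet A) (hB : MeasurableSet B)
    (hAB : ∀ x ∈ A, ∀ j ∈ Finset.range (r + 1), x + j * h ∈ B) :
    ∫⁻ x in A, ‖D r h u x‖ₑ ^ q ≤ (2 ^ r) ^ q * (r + 1) * ∫⁻ x in B, ‖u x‖ₑ ^ q := by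
  calc ∫⁻ x in A, ‖D r h u x‖ₑ ^ q
      ≤ ∫⁻ x in A, (2 ^ r) ^ q * ∑ j ∈ Finset.range (r + 1), ‖u (x + j * h)‖ₑ ^ q :=
        lintegral_mono fun x => D_pow_le r h u x q hq
    _ = (2 ^ r) ^ q * ∑ j ∈ Finset.range (r + 1), ∫⁻ x in A, ‖u (x + j * h)‖ₑ ^ q := by
        rw [lintegral_const_mul _ (by fun_prop), lintegral_finsetSum _ (fun j _ => by fun_prop)]
    _ ≤ (2 ^ r) ^ q * ∑ j ∈ Finset.range (r + 1), ∫⁻ x in B, ‖u x‖ₑ ^ q := by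
        refine mul_le_mul_right (Finset.sum_le_sum fun j hj => ?_) _
        rw [← lintegral_indicator hA, ← lintegral_indicator hB,
          ← lintegral_add_right_eq_self (B.indicator fun x => ‖u x‖ₑ ^ q) ((j:ℝ) * h)]
        apply lintegral_mono
        intro x
        by_cases hx : x ∈ A
        · simp [hx, hAB x hx j hj]
        · simp [hx]
    _ = _ := by
        rw [Finset.sum_const, Finset.card_range, nsmul_eq_mul, mul_assoc]
        push_cast; rfl

lemma shift_ae (r : ℕ) (h : ℝ) (u : ℝ → ℝ)
    (A B : Set ℝ) (hA : MeasurableSet A) (hB : MeasurableSet B)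
    (hAB : ∀ x ∈ A, ∀ j ∈ Finset.range (r + 1), x + j * h ∈ B) (b : ℝ≥0∞)
    (hb : ∀ᵐ x ∂(volume.restrict B), ‖u x‖ₑ ≤ b) :
    ∀ᵐ x ∂(volume.restrict A), ‖D r h u x‖ₑ ≤ 2 ^ r * b := by
  rw [ae_restrict_iff' hA]
  rw [ae_restrict_iff' hB] at hb
  have : ∀ᵐ x : ℝ, ∀ j ∈ Finset.range (r + 1), (x + j * h ∈ B → ‖u (x + j * h)‖ₑ ≤ b) := by
    rw [Filter.eventually_all_finset]
    intro j _
    exact (measurePreserving_add_right volume ((j:ℝ) * h)).quasiMeasurePreserving.ae hb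
  filter_upwards [this] with x hx hxA
  exact D_enorm_le r h u x b fun j hj => hx j hj (hAB x hxA j hj)

lemma D_local (m : ℕ) (N : ℝ) (h x : ℝ) (u : ℝ → ℝ) (n : ℤ) (P : Polynomial ℝ) (c : ℝ)
    (hP : P.natDegree ≤ m)
    (hu : ∀ x : ℝ, (n:ℝ) - 1 ≤ N * x → N * x < n + 1 → u x = P.eval x + c * tp m (N * x - n))
    (hx : ∀ j ∈ Finset.range (m + 2), (n:ℝ) - 1 ≤ N * (x + j * h) ∧ N * (x + j * h) < n + 1) :
    D (m + 1) h u x = c * D (m + 1) h (fun y => tp m (N * y - n)) x := by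
  have h0 := D_poly m h P hP x
  have : D (m + 1) h u x = D (m + 1) h (fun y => P.eval y) x
      + c * D (m + 1) h (fun y => tp m (N * y - n)) x := by
    unfold D
    rw [Finset.mul_sum, ← Finset.sum_add_distrib]
    refine Finset.sum_congr rfl fun j hj => ?_
    rw [hu _ (hx j hj).1 (hx j hj).2]
    ring
  rw [this, h0, zero_add]

lemma coef_bound (m : ℕ) (N : ℝ) (hN : 0 < N) (x : ℝ) (u : ℝ → ℝ) (n : ℤ) (P : Polynomial ℝ)
    (c : ℝ) (hP : P.natDegree ≤ m)
    (hu : ∀ x : ℝ, (n:ℝ) - 1 ≤ N * x → N * x < n + 1 → u x = P.eval x + c * tp m (N * x - n))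
    (h1 : (n:ℝ) - 1 + 1 / (2 * (m + 1)) ≤ N * x) (h2 : N * x < n - 1 + 1 / (m + 1)) :
    ‖c‖ₑ ≤ ENNReal.ofReal ((2 * (m + 1)) ^ m) * ‖D (m + 1) (1 / ((m + 1) * N)) u x‖ₑ := by
  have hm : (0:ℝ) < m + 1 := by positivity
  have hs : ∀ j : ℕ, N * (x + j * (1 / ((m + 1) * N))) = N * x + j / (m + 1) := by
    intro j; field_simp
  have hpos : 0 < 1 / (2 * ((m:ℝ) + 1)) := by positivity
  have hle1 : 1 / ((m:ℝ) + 1) ≤ 1 := by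
    rw [div_le_one hm]; linarith [(Nat.cast_nonneg m : (0:ℝ) ≤ m)]
  rw [D_local m N _ x u n P c hP hu]
  · have hD : D (m + 1) (1 / ((m + 1) * N)) (fun y => tp m (N * y - n)) x =
        (N * x + 1 - n) ^ m := by
      unfold D
      rw [Finset.sum_range_succ, Finset.sum_eq_zero]
      · have : N * (x + ((m + 1 : ℕ):ℝ) * (1 / ((m + 1) * N))) - n = N * x + 1 - n := by
          rw [hs]; push_cast; rw [div_self hm.ne']
        show 0 + (-1) ^ (m + 1 - (m + 1)) * (((m + 1).choose (m + 1) : ℕ) : ℝ) *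
          tp m (N * (x + ((m + 1 : ℕ):ℝ) * (1 / ((m + 1) * N))) - n) = _
        rw [this]
        simp only [tp]
        rw [if_pos (by linarith)]
        simp
      · intro j hj
        have hj' : (j:ℝ) ≤ m := by exact_mod_cast Nat.lt_succ_iff.1 (Finset.mem_range.1 hj)
        have h3 : (j:ℝ) / (m + 1) ≤ 1 - 1 / (m + 1) := by
          rw [div_le_iff₀ hm]; field_simp; linarith
        simp only [tp]
        rw [if_neg (by rw [hs]; linarith)]
        simp
    rw [hD]
    have h4 : 1 / (2 * ((m:ℝ) + 1)) ≤ N * x + 1 - n := by linarith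
    have h5 : (1 / (2 * ((m:ℝ) + 1))) ^ m ≤ (N * x + 1 - n) ^ m :=
      pow_le_pow_left₀ hpos.le h4 m
    have h6 : |c| ≤ (2 * (m + 1)) ^ m * |c * (N * x + 1 - n) ^ m| := by
      rw [abs_mul, abs_of_nonneg (a := (N * x + 1 - n) ^ m) ((by positivity : (0:ℝ) ≤ _).trans h5)]
      calc |c| = (2 * ((m:ℝ) + 1)) ^ m * (|c| * (1 / (2 * ((m:ℝ) + 1))) ^ m) := by
            rw [mul_comm |c|, ← mul_assoc, ← mul_pow, mul_one_div_cancel (by positivity)]; simp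
        _ ≤ _ := by gcongr
    rw [← ofReal_norm, ← ofReal_norm, ← ENNReal.ofReal_mul (by positivity)]
    exact ENNReal.ofReal_le_ofReal h6
  · intro j hj
    have hj' : (j:ℝ) ≤ m + 1 := by exact_mod_cast Nat.lt_succ_iff.1 (Finset.mem_range.1 hj)
    rw [hs]
    have h3 : (j:ℝ) / (m + 1) ≤ 1 := by rw [div_le_one hm]; exact hj'
    have h4 : 0 ≤ (j:ℝ) / (m + 1) := by positivity
    constructor <;> linarith

lemma conv_pt (a b : ℝ) (m j : ℕ) (hj : j ∈ Finset.range (m + 2)) (h : ℝ) (x : ℝ)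
    (h1 : a ≤ x) (h2 : x < b) (h3 : a ≤ x + ((m + 1 : ℕ):ℝ) * h)
    (h4 : x + ((m + 1 : ℕ):ℝ) * h < b) : a ≤ x + j * h ∧ x + j * h < b := by
  have hj' : (j:ℝ) ≤ ((m + 1 : ℕ):ℝ) := by exact_mod_cast Nat.lt_succ_iff.1 (Finset.mem_range.1 hj)
  have hj0 : (0:ℝ) ≤ j := by positivity
  rcases le_total 0 h with hh | hh
  · constructor <;> nlinarith
  · constructor <;> nlinarith

lemma small_bound (m N : ℕ) (hN : 0 < N) (h x : ℝ) (u : ℝ → ℝ) (P : ℤ → Polynomial ℝ)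
    (c : ℤ → ℝ) (hP : ∀ n, (P n).natDegree ≤ m)
    (hu : ∀ n : ℤ, ∀ x : ℝ, (n:ℝ) - 1 ≤ N * x → N * x < n + 1 →
      u x = (P n).eval x + c n * tp m (N * x - n))
    (hs : (m + 1) * N * |h| < 1)
    (hx0 : 0 ≤ x) (hx1 : x < 1) (hx2 : 0 ≤ x + ((m + 1 : ℕ):ℝ) * h)
    (hx3 : x + ((m + 1 : ℕ):ℝ) * h < 1) :
    D (m + 1) h u x = 0 ∨ ∃ n ∈ Finset.Ico 1 N, |N * x - n| ≤ (m + 1) * N * |h| ∧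
      ‖D (m + 1) h u x‖ₑ ≤ 2 ^ (m + 1) * ENNReal.ofReal (((m + 1) * N * |h|) ^ m) * ‖c n‖ₑ := by
  have hN' : (0:ℝ) < N := by exact_mod_cast hN
  set a := ⌊(N:ℝ) * x⌋ with ha
  set b := ⌊(N:ℝ) * (x + ((m + 1 : ℕ):ℝ) * h)⌋ with hb
  set s := ((m:ℝ) + 1) * N * |h| with hsd
  have a1 := Int.floor_le ((N:ℝ) * x)
  have a2 := Int.lt_floor_add_one ((N:ℝ) * x)
  have b1 := Int.floor_le ((N:ℝ) * (x + ((m + 1 : ℕ):ℝ) * h))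
  have b2 := Int.lt_floor_add_one ((N:ℝ) * (x + ((m + 1 : ℕ):ℝ) * h))
  rw [← ha] at a1 a2
  rw [← hb] at b1 b2
  have hdist : |(N:ℝ) * (x + ((m + 1 : ℕ):ℝ) * h) - N * x| = s := by
    rw [show (N:ℝ) * (x + ((m + 1 : ℕ):ℝ) * h) - N * x = ((m + 1 : ℕ):ℝ) * N * h by ring,
      abs_mul, abs_of_nonneg (by positivity)]
    push_cast; rfl
  have ha0 : 0 ≤ a := Int.floor_nonneg.2 (by positivity)
  have hb0 : 0 ≤ b := Int.floor_nonneg.2 (by positivity)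
  have haN : a < N := Int.floor_lt.2 (by rw [Int.cast_natCast]; nlinarith)
  have hbN : b < N := Int.floor_lt.2 (by rw [Int.cast_natCast]; nlinarith)
  have pts : ∀ n : ℤ, (n:ℝ) - 1 ≤ N * x → N * x < n + 1 →
      (n:ℝ) - 1 ≤ N * (x + ((m + 1 : ℕ):ℝ) * h) → N * (x + ((m + 1 : ℕ):ℝ) * h) < n + 1 →
      ∀ j ∈ Finset.range (m + 2), (n:ℝ) - 1 ≤ N * (x + j * h) ∧ N * (x + j * h) < n + 1 := by
    intro n h1 h2 h3 h4 j hj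
    have := conv_pt ((n:ℝ) - 1) (n + 1) m j hj (N * h) (N * x) h1 h2 (by linarith) (by linarith)
    constructor <;> linarith [this.1, this.2]
  obtain ⟨hd1, hd2⟩ := abs_le.1 hdist.le
  by_cases hab : a = b
  · left
    rw [D_local m N h x u (a + 1) (P (a + 1)) (c (a + 1)) (hP _) (hu _)]
    · have : D (m + 1) h (fun y => tp m (N * y - ((a + 1 : ℤ) : ℝ))) x = 0 := by
        unfold D
        apply Finset.sum_eq_zero
        intro j hj
        rw [← hab] at b1 b2
        have := conv_pt (a:ℝ) (a + 1) m j hj (N * h) (N * x) a1 a2 (by linarith) (by linarith)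
        have hn : ¬ 0 ≤ (N:ℝ) * (x + j * h) - ((a + 1 : ℤ) : ℝ) := by
          push_cast; linarith [this.2]
        simp only [tp, if_neg hn, mul_zero]
      rw [this, mul_zero]
    · rw [← hab] at b1 b2
      apply pts <;> rw [Int.cast_add, Int.cast_one] <;> linarith
  · right
    have hcase : ∃ n : ℤ, 1 ≤ n ∧ n < N ∧ (n:ℝ) - 1 ≤ N * x ∧ N * x < n + 1 ∧
        (n:ℝ) - 1 ≤ N * (x + ((m + 1 : ℕ):ℝ) * h) ∧ N * (x + ((m + 1 : ℕ):ℝ) * h) < n + 1 ∧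
        |(N:ℝ) * x - n| ≤ s ∧ |N * (x + ((m + 1 : ℕ):ℝ) * h) - n| ≤ s := by
      rcases lt_or_gt_of_ne hab with hlt | hlt
      · have h1 : (a:ℝ) + 1 ≤ b := by exact_mod_cast hlt
        refine ⟨b, by omega, hbN, ?_, ?_, ?_, ?_, ?_, ?_⟩ <;> (try rw [abs_le]) <;>
          (try constructor) <;> linarith
      · have h1 : (b:ℝ) + 1 ≤ a := by exact_mod_cast hlt
        refine ⟨a, by omega, haN, ?_, ?_, ?_, ?_, ?_, ?_⟩ <;> (try rw [abs_le]) <;>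
          (try constructor) <;> linarith
    obtain ⟨n, n1, nN, e1, e2, e3, e4, e5, e6⟩ := hcase
    lift n to ℕ using by omega
    refine ⟨n, Finset.mem_Ico.2 ⟨by omega, by omega⟩, by simpa using e5, ?_⟩
    rw [D_local m N h x u n (P n) (c n) (hP _) (hu _) (pts n e1 e2 e3 e4), enorm_mul, mul_comm]
    gcongr
    apply D_enorm_le
    intro j hj
    obtain ⟨f1, f2⟩ := abs_le.1 e5
    obtain ⟨f3, f4⟩ := abs_le.1 e6
    have hle : N * (x + j * h) - n ≤ s := by
      have := conv_pt (-s) (s + (1:ℝ)) m j hj (N * h) (N * x - (n:ℤ)) f1 (by linarith)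
        (by linarith) (by linarith)
      have hj' : (j:ℝ) ≤ ((m + 1 : ℕ):ℝ) := by
        exact_mod_cast Nat.lt_succ_iff.1 (Finset.mem_range.1 hj)
      have hj0 : (0:ℝ) ≤ j := by positivity
      simp only [Int.cast_natCast] at f1 f2 f3 f4
      rcases le_total 0 (N * h) with hh | hh
      · nlinarith
      · nlinarith
    rw [← ofReal_norm]
    apply ENNReal.ofReal_le_ofReal
    simp only [tp, Int.cast_natCast]
    split_ifs with h0
    · rw [Real.norm_of_nonneg (by positivity)]
      exact pow_le_pow_left₀ h0 hle m
    · simp only [norm_zero]; positivity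
end SparseGrid

namespace SparseGrid

def Eset (r : ℕ) (h : ℝ) : Set ℝ := {y | y ∈ Set.Icc (0:ℝ) 1 ∧ y + r * h ∈ Set.Icc (0:ℝ) 1}

lemma Eset_meas (r : ℕ) (h : ℝ) : MeasurableSet (Eset r h) :=
  measurableSet_Icc.inter (measurableSet_Icc.preimage (by fun_prop))

lemma Eset_pts (m : ℕ) (h : ℝ) : ∀ x ∈ Eset (m + 1) h, ∀ j ∈ Finset.range (m + 1 + 1),
    x + j * h ∈ Set.Icc (0:ℝ) 1 := by
  rintro x ⟨⟨h1, h2⟩, h3, h4⟩ j hj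
  have hj' : (j:ℝ) ≤ ((m + 1 : ℕ):ℝ) := by exact_mod_cast Nat.lt_succ_iff.1 (Finset.mem_range.1 hj)
  have hj0 : (0:ℝ) ≤ j := by positivity
  rcases le_total 0 h with hh | hh
  · constructor <;> nlinarith
  · constructor <;> nlinarith

/-- The set where knot coefficients are read off. -/
def Aset (m N n : ℕ) : Set ℝ :=
  Set.Ico (((n:ℝ) - 1 + 1 / (2 * (m + 1))) / N) (((n:ℝ) - 1 + 1 / (m + 1)) / N)

def Bset (N n : ℕ) : Set ℝ := Set.Ico (((n:ℝ) - 1) / N) (((n:ℝ) + 1) / N)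

lemma Aset_pts (m N n : ℕ) (hN : 0 < N) : ∀ x ∈ Aset m N n, ∀ j ∈ Finset.range (m + 1 + 1),
    x + j * (1 / (((m:ℝ) + 1) * N)) ∈ Bset N n := by
  rintro x ⟨h1, h2⟩ j hj
  have hN' : (0:ℝ) < N := by exact_mod_cast hN
  have hm : (0:ℝ) < m + 1 := by positivity
  rw [div_le_iff₀ hN'] at h1
  rw [lt_div_iff₀ hN'] at h2
  have hj' : (j:ℝ) ≤ m + 1 := by exact_mod_cast Nat.lt_succ_iff.1 (Finset.mem_range.1 hj)
  have h3 : (j:ℝ) / (m + 1) ≤ 1 := by rw [div_le_one hm]; exact hj'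
  have h4 : 0 ≤ (j:ℝ) / (m + 1) := by positivity
  have hle1 : 1 / ((m:ℝ) + 1) ≤ 1 := by
    rw [div_le_one hm]; linarith [(Nat.cast_nonneg m : (0:ℝ) ≤ m)]
  have hpos : 0 < 1 / (2 * ((m:ℝ) + 1)) := by positivity
  have e : (x + j * (1 / (((m:ℝ) + 1) * N))) * N = x * N + j / (m + 1) := by field_simp
  constructor
  · rw [div_le_iff₀ hN', e]; linarith
  · rw [lt_div_iff₀ hN', e]; linarith

lemma Aset_vol (m N n : ℕ) (hN : 0 < N) :
    volume (Aset m N n) = ENNReal.ofReal (1 / (2 * (m + 1) * N)) := by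
  have hN' : (0:ℝ) < N := by exact_mod_cast hN
  rw [Aset, Real.volume_Ico]
  congr 1
  field_simp
  ring

lemma Bset_sub (N n : ℕ) (hn : n ∈ Finset.Ico 1 N) : Bset N n ⊆ Set.Icc 0 1 := by
  obtain ⟨h1, h2⟩ := Finset.mem_Ico.1 hn
  have hN' : (0:ℝ) < N := by exact_mod_cast (by omega : 0 < N)
  have h1' : (1:ℝ) ≤ n := by exact_mod_cast h1
  have h2' : (n:ℝ) + 1 ≤ N := by exact_mod_cast h2
  rintro x ⟨h3, h4⟩
  rw [div_le_iff₀ hN'] at h3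
  rw [lt_div_iff₀ hN'] at h4
  constructor <;> nlinarith

lemma Bset_sum (N : ℕ) (F : ℝ → ℝ≥0∞) (hF : Measurable F) :
    ∑ n ∈ Finset.Ico 1 N, ∫⁻ x in Bset N n, F x ≤ 2 * ∫⁻ x in Set.Icc (0:ℝ) 1, F x := by
  have e : ∀ n, MeasurableSet (Bset N n) := fun n => measurableSet_Ico
  simp_rw [← lintegral_indicator (e _)]
  rw [← lintegral_indicator measurableSet_Icc, ← lintegral_finsetSum _
    (fun n _ => hF.indicator (e n)), ← lintegral_const_mul _ (hF.indicator measurableSet_Icc)]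
  apply lintegral_mono
  intro x
  show ∑ n ∈ Finset.Ico 1 N, (Bset N n).indicator F x ≤ 2 * (Set.Icc (0:ℝ) 1).indicator F x
  by_cases hx : x ∈ Set.Icc (0:ℝ) 1
  · rw [Set.indicator_of_mem hx]
    simp only [Set.indicator_apply]
    rw [← Finset.sum_filter, Finset.sum_const, nsmul_eq_mul]
    gcongr
    have : (Finset.Ico 1 N).filter (fun n => x ∈ Bset N n) ⊆
        {⌊(N:ℝ) * x⌋₊, ⌊(N:ℝ) * x⌋₊ + 1} := by
      intro n hn
      obtain ⟨hn1, h3, h4⟩ := Finset.mem_filter.1 hn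
      obtain ⟨h1, h2⟩ := Finset.mem_Ico.1 hn1
      have hN' : (0:ℝ) < N := by exact_mod_cast (by omega : 0 < N)
      rw [div_le_iff₀ hN'] at h3
      rw [lt_div_iff₀ hN'] at h4
      have hnn : 0 ≤ (N:ℝ) * x := mul_nonneg hN'.le hx.1
      have h5 : ⌊(N:ℝ) * x⌋₊ < n + 1 := by
        rw [Nat.floor_lt hnn]; push_cast; linarith
      have h6 : n - 1 ≤ ⌊(N:ℝ) * x⌋₊ := by
        rw [Nat.le_floor_iff hnn]; push_cast [h1]; linarith
      simp only [Finset.mem_insert, Finset.mem_singleton]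
      omega
    have hc := (Finset.card_le_card this).trans Finset.card_le_two
    exact_mod_cast hc
  · rw [Set.indicator_of_notMem hx, mul_zero]
    refine (Finset.sum_eq_zero fun n hn => ?_).le
    exact Set.indicator_of_notMem (fun h => hx (Bset_sub N n hn h)) _

lemma Eset_ae (m : ℕ) (h : ℝ) (Q : ℝ → Prop)
    (hQ : ∀ x, 0 ≤ x → x < 1 → 0 ≤ x + ((m + 1 : ℕ):ℝ) * h → x + ((m + 1 : ℕ):ℝ) * h < 1 → Q x) :
    ∀ᵐ x ∂(volume.restrict (Eset (m + 1) h)), Q x := by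
  rw [ae_restrict_iff' (Eset_meas _ _)]
  have h1 : ∀ᵐ x : ℝ, x ≠ 1 := by simp [ae_iff, measure_singleton]
  have h2 : ∀ᵐ x : ℝ, x ≠ 1 - ((m + 1 : ℕ):ℝ) * h := by simp [ae_iff, measure_singleton]
  filter_upwards [h1, h2] with x hx1 hx2 hx
  obtain ⟨⟨a1, a2⟩, a3, a4⟩ := hx
  exact hQ x a1 (lt_of_le_of_ne a2 hx1) a3 (lt_of_le_of_ne a4 fun h' => hx2 (by linarith))

/-- Small-step integral estimate. -/
lemma small_int (m N : ℕ) (hN : 0 < N) (h : ℝ) (u : ℝ → ℝ) (hu : u ∈ Spl m N)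
    (hum : Measurable u) (q : ℝ) (hq : 0 < q) (hs : (m + 1) * N * |h| < 1) :
    ∫⁻ x in Eset (m + 1) h, ‖D (m + 1) h u x‖ₑ ^ q ≤
      ENNReal.ofReal (4 * (m + 1) * ((m + 1) * N * |h|)) *
        (2 ^ (m + 1) * ENNReal.ofReal (((m + 1) * N * |h|) ^ m)) ^ q *
        (ENNReal.ofReal ((2 * (m + 1)) ^ m) ^ q * ((2 ^ (m + 1)) ^ q * ((m + 1 : ℕ) + 1)) * 2) *
        ∫⁻ x in Set.Icc (0:ℝ) 1, ‖u x‖ₑ ^ q := by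
  have hN' : (0:ℝ) < N := by exact_mod_cast hN
  choose P c hP hc using hu
  set s := ((m:ℝ) + 1) * N * |h| with hsd
  have hs0 : 0 ≤ s := by positivity
  set G : ℝ≥0∞ := 2 ^ (m + 1) * ENNReal.ofReal (s ^ m) with hG
  set F : ℝ → ℝ≥0∞ := fun x => ‖u x‖ₑ ^ q with hF
  have hFm : Measurable F := by fun_prop
  have hcoef : ∀ n ∈ Finset.Ico 1 N, ‖c n‖ₑ ^ q * ENNReal.ofReal (1 / (2 * (m + 1) * N)) ≤
      ENNReal.ofReal ((2 * (m + 1)) ^ m) ^ q * ((2 ^ (m + 1)) ^ q * ((m + 1 : ℕ) + 1)) *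
        ∫⁻ x in Bset N n, F x := by
    intro n hn
    rw [← Aset_vol m N n hN, ← setLIntegral_const]
    calc ∫⁻ x in Aset m N n, ‖c n‖ₑ ^ q
        ≤ ∫⁻ x in Aset m N n, ENNReal.ofReal ((2 * (m + 1)) ^ m) ^ q *
            ‖D (m + 1) (1 / ((m + 1) * N)) u x‖ₑ ^ q := by
          refine setLIntegral_mono' measurableSet_Ico fun x hx => ?_
          rw [← ENNReal.mul_rpow_of_nonneg _ _ hq.le]
          refine ENNReal.rpow_le_rpow ?_ hq.le
          obtain ⟨h1, h2⟩ := hx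
          rw [div_le_iff₀ hN'] at h1
          rw [lt_div_iff₀ hN'] at h2
          exact coef_bound m N hN' x u n (P n) (c n) (hP n) (hc n)
            (by push_cast; linarith) (by push_cast; linarith)
      _ = ENNReal.ofReal ((2 * (m + 1)) ^ m) ^ q *
            ∫⁻ x in Aset m N n, ‖D (m + 1) (1 / ((m + 1) * N)) u x‖ₑ ^ q := by
          rw [lintegral_const_mul _ ((D_measurable _ _ _ hum).enorm.pow_const q)]
      _ ≤ _ := by
          rw [mul_assoc]
          refine mul_le_mul_right ?_ _
          exact shift_int (m + 1) _ u hum q hq _ _ measurableSet_Ico measurableSet_Ico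
            (Aset_pts m N n hN)
  calc ∫⁻ x in Eset (m + 1) h, ‖D (m + 1) h u x‖ₑ ^ q
      ≤ ∫⁻ x in Eset (m + 1) h, ∑ n ∈ Finset.Ico 1 N,
          (Metric.closedBall ((n:ℝ) / N) ((m + 1) * |h|)).indicator
            (fun _ => (G * ‖c n‖ₑ) ^ q) x := by
        apply lintegral_mono_ae
        apply Eset_ae
        intro x h1 h2 h3 h4
        rcases small_bound m N hN h x u P c hP hc hs h1 h2 h3 h4 with h0 | ⟨n, hn, h5, h6⟩
        · rw [h0]; simp [hq]
        · refine le_trans ?_ (Finset.single_le_sum (fun _ _ => zero_le) hn)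
          rw [Set.indicator_of_mem]
          · exact ENNReal.rpow_le_rpow h6 hq.le
          · rw [Metric.mem_closedBall, Real.dist_eq]
            have : x - n / N = (N * x - n) / N := by field_simp
            rw [this, abs_div, abs_of_pos hN', div_le_iff₀ hN']
            linarith
    _ ≤ ∫⁻ x, ∑ n ∈ Finset.Ico 1 N,
          (Metric.closedBall ((n:ℝ) / N) ((m + 1) * |h|)).indicator
            (fun _ => (G * ‖c n‖ₑ) ^ q) x := setLIntegral_le_lintegral _ _
    _ = ∑ n ∈ Finset.Ico 1 N, (G * ‖c n‖ₑ) ^ q * ENNReal.ofReal (2 * ((m + 1) * |h|)) := by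
        rw [lintegral_finsetSum _ (fun n _ =>
          measurable_const.indicator Metric.isClosed_closedBall.measurableSet)]
        refine Finset.sum_congr rfl fun n _ => ?_
        rw [lintegral_indicator_const Metric.isClosed_closedBall.measurableSet,
          Real.volume_closedBall]
    _ = ENNReal.ofReal (4 * (m + 1) * s) * G ^ q * ∑ n ∈ Finset.Ico 1 N,
          ‖c n‖ₑ ^ q * ENNReal.ofReal (1 / (2 * (m + 1) * N)) := by
        rw [Finset.mul_sum]
        refine Finset.sum_congr rfl fun n _ => ?_
        have : 2 * (((m:ℝ) + 1) * |h|) = (4 * (m + 1) * s) * (1 / (2 * (m + 1) * N)) := by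
          rw [hsd]; field_simp; ring
        rw [this, ENNReal.ofReal_mul (by positivity), ENNReal.mul_rpow_of_nonneg _ _ hq.le]
        ring
    _ ≤ ENNReal.ofReal (4 * (m + 1) * s) * G ^ q * ∑ n ∈ Finset.Ico 1 N,
          (ENNReal.ofReal ((2 * (m + 1)) ^ m) ^ q * ((2 ^ (m + 1)) ^ q * ((m + 1 : ℕ) + 1)) *
          ∫⁻ x in Bset N n, F x) := by
        refine mul_le_mul_right (Finset.sum_le_sum hcoef) _
    _ ≤ _ := by
        rw [← Finset.mul_sum]
        calc _ ≤ ENNReal.ofReal (4 * (m + 1) * s) * G ^ q *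
            (ENNReal.ofReal ((2 * (m + 1)) ^ m) ^ q * ((2 ^ (m + 1)) ^ q * ((m + 1 : ℕ) + 1)) *
              (2 * ∫⁻ x in Set.Icc (0:ℝ) 1, F x)) := by
              gcongr
              exact Bset_sum N F hFm
          _ = _ := by ring

lemma min_step (m N : ℕ) (h τ : ℝ) (hτ : |h| ≤ τ) :
    min 1 ((m + 1) * N * |h|) ≤ (m + 1) * min 1 (N * τ) := by
  have hm : (0:ℝ) ≤ m := by positivity
  have hN : (0:ℝ) ≤ N := by positivity
  rw [mul_min_of_nonneg _ _ (by positivity)]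
  apply min_le_min
  · linarith
  · rw [mul_assoc]; gcongr

lemma oneD_fin (m : ℕ) (q : ℝ) (hq : 0 < q) : ∃ C > (0:ℝ), ∀ N : ℕ, 0 < N → ∀ u ∈ Spl m N,
    Measurable u → ∀ h τ : ℝ, |h| ≤ τ →
    ∫⁻ x in Eset (m + 1) h, ‖D (m + 1) h u x‖ₑ ^ q ≤
      ENNReal.ofReal (C * (min 1 (N * τ)) ^ (m + 1 / q)) ^ q *
        ∫⁻ x in Set.Icc (0:ℝ) 1, ‖u x‖ₑ ^ q := by
  set K0 : ℝ := (2 ^ (m + 1)) ^ q * ((m + 1 : ℕ) + 1) with hK0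
  set K1 : ℝ := 4 * (m + 1) * ((2 ^ (m + 1)) ^ q * ((((2 * ((m:ℝ) + 1)) ^ m) ^ q * K0) * 2)) with hK1
  have hK0' : 0 < K0 := by positivity
  have hK1' : 0 < K1 := by positivity
  have two : ((2:ℝ≥0∞) ^ (m + 1)) ^ q = ENNReal.ofReal (((2:ℝ) ^ (m + 1)) ^ q) := by
    rw [← ENNReal.ofReal_rpow_of_nonneg (by positivity) hq.le, ENNReal.ofReal_pow (by norm_num)]
    simp
  have cast : (((m + 1 : ℕ):ℝ≥0∞) + 1) = ENNReal.ofReal (((m + 1 : ℕ):ℝ) + 1) := by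
    rw [ENNReal.ofReal_add (by positivity) (by norm_num), ENNReal.ofReal_natCast]; simp
  have eK0 : (2 ^ (m + 1)) ^ q * (((m + 1 : ℕ):ℝ≥0∞) + 1) = ENNReal.ofReal K0 := by
    rw [two, cast, ← ENNReal.ofReal_mul (by positivity)]
  set K := max K0 K1 with hK
  have hKpos : 0 < K := lt_max_of_lt_left hK0'
  refine ⟨K ^ (1/q) * (m + 1) ^ (m + 1 / q), by positivity, ?_⟩
  intro N hN u hu hum h τ hτ
  set s := ((m:ℝ) + 1) * N * |h| with hsd
  have hs0 : 0 ≤ s := by positivity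
  have hτ0 : 0 ≤ τ := (abs_nonneg h).trans hτ
  have hmin0 : 0 ≤ min 1 ((N:ℝ) * τ) := by positivity
  have main : ∫⁻ x in Eset (m + 1) h, ‖D (m + 1) h u x‖ₑ ^ q ≤
      ENNReal.ofReal (K * (min 1 s) ^ (m * q + 1)) * ∫⁻ x in Set.Icc (0:ℝ) 1, ‖u x‖ₑ ^ q := by
    by_cases hs : s < 1
    · refine (small_int m N hN h u hu hum q hq hs).trans ?_
      gcongr
      rw [eK0, ENNReal.mul_rpow_of_nonneg _ _ hq.le, two,
        ENNReal.ofReal_rpow_of_nonneg (by positivity) hq.le,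
        ENNReal.ofReal_rpow_of_nonneg (by positivity) hq.le,
        show (2:ℝ≥0∞) = ENNReal.ofReal 2 by simp,
        ← ENNReal.ofReal_mul (by positivity), ← ENNReal.ofReal_mul (by positivity),
        ← ENNReal.ofReal_mul (by positivity), ← ENNReal.ofReal_mul (by positivity),
        ← ENNReal.ofReal_mul (by positivity)]
      apply ENNReal.ofReal_le_ofReal
      rw [min_eq_right hs.le]
      have e : s ^ ((m:ℝ) * q + 1) = s * (s ^ m) ^ q := by
        rw [← Real.rpow_natCast, ← Real.rpow_mul hs0]
        rw [Real.rpow_add_one' hs0 (by positivity), mul_comm]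
      rw [e]
      calc _ = K1 * (s * (s ^ m) ^ q) := by rw [hK1]; ring
        _ ≤ _ := by gcongr; exact le_max_right _ _
    · refine (shift_int (m + 1) h u hum q hq _ _ (Eset_meas _ _) measurableSet_Icc
        (Eset_pts m h)).trans ?_
      rw [eK0, min_eq_left (not_lt.1 hs), Real.one_rpow, mul_one]
      gcongr
      exact le_max_left _ _
  refine main.trans ?_
  gcongr
  rw [ENNReal.ofReal_rpow_of_nonneg (by positivity) hq.le]
  apply ENNReal.ofReal_le_ofReal
  rw [mul_assoc, ← Real.mul_rpow (by positivity) hmin0, Real.mul_rpow (by positivity)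
    (by positivity), ← Real.rpow_mul hKpos.le, ← Real.rpow_mul (by positivity)]
  rw [one_div_mul_cancel hq.ne', Real.rpow_one]
  have e : ((m:ℝ) + 1 / q) * q = m * q + 1 := by field_simp
  rw [e]
  gcongr
  exact min_step m N h τ hτ

lemma oneD_top (m : ℕ) : ∃ C > (0:ℝ), ∀ N : ℕ, 0 < N → ∀ u ∈ Spl m N,
    ∀ h τ : ℝ, |h| ≤ τ → ∀ b : ℝ≥0∞,
    (∀ᵐ x ∂(volume.restrict (Set.Icc (0:ℝ) 1)), ‖u x‖ₑ ≤ b) →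
    ∀ᵐ x ∂(volume.restrict (Eset (m + 1) h)), ‖D (m + 1) h u x‖ₑ ≤
      ENNReal.ofReal (C * (min 1 (N * τ)) ^ m) * b := by
  set K0 : ℝ := 2 ^ (m + 1) with hK0
  set K1 : ℝ := 2 ^ (m + 1) * ((2 * (m + 1)) ^ m * 2 ^ (m + 1)) with hK1
  have hK0' : 0 < K0 := by positivity
  set K := max K0 K1 with hK
  have hKpos : 0 < K := lt_max_of_lt_left hK0'
  have two : (2:ℝ≥0∞) ^ (m + 1) = ENNReal.ofReal K0 := by
    rw [ENNReal.ofReal_pow (by norm_num)]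
    simp
  refine ⟨K * (m + 1) ^ m, by positivity, ?_⟩
  intro N hN u hu h τ hτ b hb
  have hN' : (0:ℝ) < N := by exact_mod_cast hN
  set s := ((m:ℝ) + 1) * N * |h| with hsd
  have hs0 : 0 ≤ s := by positivity
  have hτ0 : 0 ≤ τ := (abs_nonneg h).trans hτ
  have hmin0 : 0 ≤ min 1 ((N:ℝ) * τ) := by positivity
  have main : ∀ᵐ x ∂(volume.restrict (Eset (m + 1) h)), ‖D (m + 1) h u x‖ₑ ≤
      ENNReal.ofReal (K * (min 1 s) ^ m) * b := by
    by_cases hs : s < 1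
    · choose P c hP hc using hu
      have hcoef : ∀ n ∈ Finset.Ico 1 N, ‖c n‖ₑ ≤
          ENNReal.ofReal ((2 * (m + 1)) ^ m * 2 ^ (m + 1)) * b := by
        intro n hn
        have h1 := shift_ae (m + 1) (1 / ((m + 1) * N)) u (Aset m N n) (Bset N n)
          measurableSet_Ico measurableSet_Ico (Aset_pts m N n hN) b
          (ae_restrict_of_ae_restrict_of_subset (Bset_sub N n hn) hb)
        have hv : volume (Aset m N n) ≠ 0 := by
          rw [Aset_vol m N n hN]
          simp only [ne_eq, ENNReal.ofReal_eq_zero, not_le]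
          positivity
        have hne : NeZero (volume.restrict (Aset m N n)) :=
          ⟨by rwa [ne_eq, Measure.restrict_eq_zero]⟩
        obtain ⟨x, hx1, hx2⟩ := (h1.and (ae_restrict_mem measurableSet_Ico)).exists
        obtain ⟨h3, h4⟩ := hx2
        rw [div_le_iff₀ hN'] at h3
        rw [lt_div_iff₀ hN'] at h4
        refine (coef_bound m N hN' x u n (P n) (c n) (hP n) (hc n)
            (by push_cast; linarith) (by push_cast; linarith)).trans ?_
        rw [ENNReal.ofReal_mul (by positivity), ← two, mul_assoc]
        exact mul_le_mul_right hx1 _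
      apply Eset_ae
      intro x h1 h2 h3 h4
      rcases small_bound m N hN h x u P c hP hc hs h1 h2 h3 h4 with h0 | ⟨n, hn, h5, h6⟩
      · rw [h0]; simp
      · refine h6.trans ((mul_le_mul_right (hcoef n hn) _).trans ?_)
        rw [two, ← mul_assoc, ← ENNReal.ofReal_mul (by positivity),
          ← ENNReal.ofReal_mul (by positivity), min_eq_right hs.le]
        refine mul_le_mul_left (ENNReal.ofReal_le_ofReal ?_) _
        calc _ = K1 * s ^ m := by rw [hK1, hK0, hsd]; ring
          _ ≤ _ := by gcongr; exact le_max_right _ _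
    · filter_upwards [shift_ae (m + 1) h u _ _ (Eset_meas _ _) measurableSet_Icc
        (Eset_pts m h) b hb] with x hx
      refine hx.trans ?_
      rw [two, min_eq_left (not_lt.1 hs), one_pow, mul_one]
      gcongr
      exact le_max_left _ _
  filter_upwards [main] with x hx
  refine hx.trans ?_
  refine mul_le_mul_left (ENNReal.ofReal_le_ofReal ?_) _
  rw [mul_assoc, ← mul_pow]
  gcongr
  exact min_step m N h τ hτ
end SparseGrid

namespace SparseGrid

lemma slice_le (d : ℕ) (i : Fin d) (s : Fin d → Set ℝ) (hs : ∀ j, MeasurableSet (s j))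
    (T : Set ℝ) (hT : MeasurableSet T) (F F' : (Fin d → ℝ) → ℝ≥0∞) (hF : Measurable F)
    (hF' : Measurable F') (K : ℝ≥0∞)
    (h : ∀ x, ∫⁻ y in T, F (Function.update x i y) ≤ K * ∫⁻ y in s i, F' (Function.update x i y)) :
    ∫⁻ x in Set.univ.pi (Function.update s i T), F x ≤ K * ∫⁻ x in Set.univ.pi s, F' x := by
  have hm1 : MeasurableSet (Set.univ.pi (Function.update s i T)) := by
    refine MeasurableSet.univ_pi fun j => ?_
    by_cases hj : j = i
    · subst hj; simpa using hT
    · simpa [hj] using hs j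
  have hm2 : MeasurableSet (Set.univ.pi s) := MeasurableSet.univ_pi hs
  rw [← lintegral_indicator hm1, ← lintegral_indicator hm2,
    ← lintegral_const_mul _ (hF'.indicator hm2)]
  refine lintegral_le_of_lmarginal_le {i} (hF.indicator hm1)
    ((hF'.indicator hm2).const_mul K) ?_
  rw [lmarginal_singleton, lmarginal_singleton]
  intro x
  have hcm : Measurable (fun y : ℝ => (Set.univ.pi s).indicator F' (Function.update x i y)) :=
    (hF'.indicator hm2).comp (measurable_update x)
  show ∫⁻ y, (Set.univ.pi (Function.update s i T)).indicator F (Function.update x i y) ≤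
    ∫⁻ y, K * (Set.univ.pi s).indicator F' (Function.update x i y)
  rw [lintegral_const_mul _ hcm]
  by_cases hx : ∀ j, j ≠ i → x j ∈ s j
  · have e1 : ∀ y, (Set.univ.pi (Function.update s i T)).indicator F (Function.update x i y) =
        T.indicator (fun y => F (Function.update x i y)) y := by
      intro y
      have : Function.update x i y ∈ Set.univ.pi (Function.update s i T) ↔ y ∈ T := by
        simp only [Set.mem_univ_pi]
        constructor
        · intro hy; simpa using hy i
        · intro hy j
          by_cases hj : j = i
          · subst hj; simpa using hy
          · simpa [hj] using hx j hj
      simp only [Set.indicator_apply, this]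
    have e2 : ∀ y, (Set.univ.pi s).indicator F' (Function.update x i y) =
        (s i).indicator (fun y => F' (Function.update x i y)) y := by
      intro y
      have : Function.update x i y ∈ Set.univ.pi s ↔ y ∈ s i := by
        simp only [Set.mem_univ_pi]
        constructor
        · intro hy; simpa using hy i
        · intro hy j
          by_cases hj : j = i
          · subst hj; simpa using hy
          · simpa [hj] using hx j hj
      simp only [Set.indicator_apply, this]
    simp_rw [e1, e2]
    rw [lintegral_indicator hT, lintegral_indicator (hs i)]
    exact h x
  · push Not at hx
    obtain ⟨j, hj, hxj⟩ := hx
    have e1 : ∀ y, (Set.univ.pi (Function.update s i T)).indicator F (Function.update x i y)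
        = 0 := by
      intro y
      apply Set.indicator_of_notMem
      intro h
      have := h j trivial
      simp [hj] at this
      exact hxj this
    simp_rw [e1]
    simp

lemma diffC_update (d r : ℕ) (i : Fin d) (h : ℝ) (G : (Fin d → ℝ) → ℝ) (x : Fin d → ℝ) (y : ℝ) :
    diffC d r i h G (Function.update x i y) = D r h (fun y => G (Function.update x i y)) y := by
  simp [diffC, D]

lemma diffC_measurable (d r : ℕ) (i : Fin d) (h : ℝ) (G : (Fin d → ℝ) → ℝ) (hG : Measurable G) :
    Measurable (diffC d r i h G) := by
  unfold diffC
  refine Finset.measurable_sum _ fun j _ => Measurable.const_mul (hG.comp ?_) _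
  refine measurable_pi_lambda _ fun l => ?_
  by_cases hl : l = i
  · subst hl; simp only [Function.update_self]; fun_prop
  · simp only [Function.update_of_ne hl]; fun_prop

lemma diff_step (d m : ℕ) (p : ℝ≥0∞) (hp : 0 < p) : ∃ C > (0:ℝ), ∀ (i : Fin d) (N : ℕ), 0 < N →
    ∀ G : (Fin d → ℝ) → ℝ, Measurable G →
    (∀ x, (fun y => G (Function.update x i y)) ∈ Spl m N) →
    ∀ s : Fin d → Set ℝ, (∀ j, MeasurableSet (s j)) → s i = Set.Icc 0 1 →
    ∀ h τ : ℝ, |h| ≤ τ →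
    eLpNorm (diffC d (m + 1) i h G) p
      (volume.restrict (Set.univ.pi (Function.update s i (Eset (m + 1) h)))) ≤
    ENNReal.ofReal (C * (min 1 (N * τ)) ^ (m + p⁻¹.toReal)) *
      eLpNorm G p (volume.restrict (Set.univ.pi s)) := by
  by_cases htop : p = ∞
  · subst htop
    obtain ⟨C, hC, hmain⟩ := oneD_top m
    refine ⟨C, hC, ?_⟩
    intro i N hN G hG hspl s hs hsi h τ hτ
    simp only [ENNReal.inv_top, ENNReal.toReal_zero, add_zero, Real.rpow_natCast]
    rw [eLpNorm_exponent_top, eLpNorm_exponent_top]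
    set b := eLpNormEssSup G (volume.restrict (Set.univ.pi s)) with hb
    set A := ENNReal.ofReal (C * (min 1 (N * τ)) ^ m) with hA
    have hDm := diffC_measurable d (m + 1) i h G hG
    set S1 : Set (Fin d → ℝ) := {x | A * b < ‖diffC d (m + 1) i h G x‖ₑ} with hS1
    set S2 : Set (Fin d → ℝ) := {x | b < ‖G x‖ₑ} with hS2
    have mS1 : MeasurableSet S1 := measurableSet_lt measurable_const hDm.enorm
    have mS2 : MeasurableSet S2 := measurableSet_lt measurable_const hG.enorm
    have z2 : ∫⁻ x in Set.univ.pi s, S2.indicator 1 x = 0 := by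
      rw [lintegral_indicator_one mS2]
      have := ae_le_eLpNormEssSup (f := G) (μ := volume.restrict (Set.univ.pi s))
      rw [ae_iff] at this
      simpa [hS2, hb] using this
    have key := slice_le d i s hs (Eset (m + 1) h) (Eset_meas _ _) (S1.indicator 1)
      (S2.indicator 1) (measurable_one.indicator mS1) (measurable_one.indicator mS2) ⊤ (by
        intro x
        have hc1 : Measurable (fun y : ℝ =>
            S1.indicator (1 : (Fin d → ℝ) → ℝ≥0∞) (Function.update x i y)) :=
          (measurable_one.indicator mS1).comp (measurable_update x)
        have hc2 : Measurable (fun y : ℝ =>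
            S2.indicator (1 : (Fin d → ℝ) → ℝ≥0∞) (Function.update x i y)) :=
          (measurable_one.indicator mS2).comp (measurable_update x)
        by_cases h0 : ∫⁻ y in s i, S2.indicator 1 (Function.update x i y) = 0
        · have h1 : ∀ᵐ y ∂(volume.restrict (Set.Icc (0:ℝ) 1)),
              ‖(fun y => G (Function.update x i y)) y‖ₑ ≤ b := by
            rw [lintegral_eq_zero_iff hc2, hsi] at h0
            filter_upwards [h0] with y hy
            by_contra hcon
            have : Function.update x i y ∈ S2 := not_le.1 hcon
            simp [this] at hy
          have h2 := hmain N hN _ (hspl x) h τ hτ b h1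
          have h3 : ∫⁻ y in Eset (m + 1) h, S1.indicator 1 (Function.update x i y) = 0 := by
            rw [lintegral_eq_zero_iff hc1]
            filter_upwards [h2] with y hy
            apply Set.indicator_of_notMem
            rw [hS1, Set.mem_ofPred_eq, not_lt, diffC_update]
            exact hy
          rw [h3]; exact zero_le
        · rw [ENNReal.top_mul h0]; exact le_top)
    rw [z2, mul_zero, nonpos_iff_eq_zero, lintegral_indicator_one mS1] at key
    apply eLpNormEssSup_le_of_ae_enorm_bound
    rw [ae_iff]
    simpa [hS1] using key
  · have hq : 0 < p.toReal := ENNReal.toReal_pos hp.ne' htop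
    obtain ⟨C, hC, hmain⟩ := oneD_fin m p.toReal hq
    refine ⟨C, hC, ?_⟩
    intro i N hN G hG hspl s hs hsi h τ hτ
    have hDm := diffC_measurable d (m + 1) i h G hG
    rw [eLpNorm_eq_lintegral_rpow_enorm_toReal hp.ne' htop,
      eLpNorm_eq_lintegral_rpow_enorm_toReal hp.ne' htop, ENNReal.toReal_inv, ← one_div]
    have key := slice_le d i s hs (Eset (m + 1) h) (Eset_meas _ _)
      (fun x => ‖diffC d (m + 1) i h G x‖ₑ ^ p.toReal) (fun x => ‖G x‖ₑ ^ p.toReal)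
      (by fun_prop) (by fun_prop)
      (ENNReal.ofReal (C * (min 1 (N * τ)) ^ (m + 1 / p.toReal)) ^ p.toReal) (by
        intro x
        rw [hsi]
        simp_rw [diffC_update]
        exact hmain N hN _ (hspl x) (hG.comp (measurable_update x)) h τ hτ)
    refine (ENNReal.rpow_le_rpow key (by positivity)).trans (le_of_eq ?_)
    rw [ENNReal.mul_rpow_of_nonneg _ _ (by positivity), ← ENNReal.rpow_mul,
      mul_one_div_cancel hq.ne', ENNReal.rpow_one]

/-- functions all of whose slices are splines -/
def Good (d m : ℕ) (N : Fin d → ℕ) (i : Fin d) (G : (Fin d → ℝ) → ℝ) : Prop :=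
  ∀ x, (fun y => G (Function.update x i y)) ∈ Spl m (N i)

lemma Good_diffC (d m r : ℕ) (N : Fin d → ℕ) (i j : Fin d) (hij : i ≠ j) (h : ℝ)
    (G : (Fin d → ℝ) → ℝ) (hG : Good d m N i G) : Good d m N i (diffC d r j h G) := by
  intro x
  have : (fun y => diffC d r j h G (Function.update x i y)) =
      ∑ l ∈ Finset.range (r + 1), ((-1 : ℝ) ^ (r - l) * (r.choose l : ℝ)) •
        (fun y => G (Function.update (Function.update x j (x j + l * h)) i y)) := by
    funext y
    simp only [diffC, Finset.sum_apply, Pi.smul_apply, smul_eq_mul]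
    refine Finset.sum_congr rfl fun l _ => ?_
    rw [Function.update_of_ne hij.symm, Function.update_comm hij]
  rw [this]
  exact Submodule.sum_mem _ fun l _ => Submodule.smul_mem _ _ (hG _)

lemma list_bound (d m : ℕ) (p : ℝ≥0∞) (hp : 0 < p) : ∃ C > (0:ℝ), ∀ (N : Fin d → ℕ),
    (∀ i, 0 < N i) →
    ∀ G : (Fin d → ℝ) → ℝ, Measurable G → (∀ i, Good d m N i G) →
    ∀ h τ : Fin d → ℝ, ∀ l : List (Fin d), l.Nodup → (∀ i ∈ l, |h i| ≤ τ i) →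
    (Measurable (l.foldr (fun i g => diffC d (m + 1) i (h i) g) G) ∧
    (∀ i, i ∉ l → Good d m N i (l.foldr (fun i g => diffC d (m + 1) i (h i) g) G))) ∧
    eLpNorm (l.foldr (fun i g => diffC d (m + 1) i (h i) g) G) p
      (volume.restrict (Set.univ.pi fun i => if i ∈ l then Eset (m + 1) (h i) else Set.Icc 0 1)) ≤
    (l.map fun i => ENNReal.ofReal (C * (min 1 (N i * τ i)) ^ (m + p⁻¹.toReal))).prod *
      eLpNorm G p (volume.restrict (cube d)) := by
  obtain ⟨C, hC, hstep⟩ := diff_step d m p hp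
  refine ⟨C, hC, ?_⟩
  intro N hN G hG hgood h τ l
  induction l with
  | nil =>
    intro _ _
    refine ⟨⟨hG, fun i _ => hgood i⟩, ?_⟩
    simp [cube]
  | cons i l ih =>
    intro hnd hle
    rw [List.nodup_cons] at hnd
    obtain ⟨⟨hm, hg⟩, hb⟩ := ih hnd.2 (fun j hj => hle j (List.mem_cons_of_mem _ hj))
    refine ⟨⟨diffC_measurable _ _ _ _ _ hm, ?_⟩, ?_⟩
    · intro j hj
      rw [List.mem_cons, not_or] at hj
      exact Good_diffC d m _ N j i hj.1 _ _ (hg j hj.2)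
    · have := hstep i (N i) (hN i) _ hm (hg i hnd.1)
        (fun i => if i ∈ l then Eset (m + 1) (h i) else Set.Icc 0 1)
        (fun j => by split_ifs <;> first | exact Eset_meas _ _ | exact measurableSet_Icc)
        (by simp [hnd.1]) (h i) (τ i) (hle i (by simp))
      have e : (Function.update (fun i => if i ∈ l then Eset (m + 1) (h i) else Set.Icc 0 1) i
          (Eset (m + 1) (h i))) =
          fun j => if j ∈ i :: l then Eset (m + 1) (h j) else Set.Icc 0 1 := by
        funext j
        by_cases hj : j = i
        · subst hj; simp
        · simp [hj]
      rw [e] at this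
      refine this.trans ?_
      rw [List.map_cons, List.prod_cons, mul_assoc]
      exact mul_le_mul_right hb _

lemma Sigma_good (d m : ℕ) (k : Fin d → ℕ) (g : (Fin d → ℝ) → ℝ) (hg : g ∈ SigmaRd d (m + 1) k) :
    Measurable g ∧ ∀ i, Good d m (fun i => 2 * 2 ^ k i) i g := by
  unfold SigmaRd at hg
  induction hg using Submodule.span_induction with
  | mem f hf =>
    obtain ⟨s, -, rfl⟩ := hf
    have hcm : Measurable (centerB (m + 1)) := TS_measurable m _ (centerB_mem m)
    constructor
    · unfold Mrks
      refine Finset.measurable_prod _ fun i _ => hcm.comp (by fun_prop)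
    · intro i x
      set z : ℤ := if Even (m + 1) then 2 * s i else s i with hz
      have ez : (if Even (m + 1) then (s i : ℝ) else (s i : ℝ) / 2) = (z:ℝ) / 2 := by
        rw [hz]; split_ifs <;> push_cast <;> ring
      have : (fun y => Mrks d (m + 1) k s (Function.update x i y)) =
          (∏ j ∈ Finset.univ.erase i, centerB (m + 1) ((2:ℝ) ^ (k j) * x j -
            (if Even (m + 1) then (s j : ℝ) else (s j : ℝ) / 2))) •
          (fun y => centerB (m + 1) ((2:ℝ) ^ (k i) * y - (z:ℝ) / 2)) := by
        funext y
        simp only [Mrks, Pi.smul_apply, smul_eq_mul]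
        rw [← Finset.prod_erase_mul _ _ (Finset.mem_univ i), Function.update_self, ez]
        congr 1
        refine Finset.prod_congr rfl fun j hj => ?_
        rw [Function.update_of_ne (Finset.ne_of_mem_erase hj)]
      rw [this]
      have := scaled_mem_Spl m (k i) z _ (centerB_mem m)
      push_cast
      exact Submodule.smul_mem _ _ this
  | zero => exact ⟨measurable_const, fun i x => Submodule.zero_mem _⟩
  | add f g _ _ hf hg =>
    exact ⟨hf.1.add hg.1, fun i x => Submodule.add_mem _ (hf.2 i x) (hg.2 i x)⟩
  | smul c f _ hf => exact ⟨hf.1.const_smul c, fun i x => Submodule.smul_mem _ c (hf.2 i x)⟩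

lemma modulus_bound (d m : ℕ) (p : ℝ≥0∞) (hp : 0 < p) : ∃ C > (0:ℝ), ∀ (k : Fin d → ℕ),
    ∀ g ∈ SigmaRd d (m + 1) k, ∀ e : Finset (Fin d), ∀ t : Fin d → ℝ,
    modulus d (m + 1) e p g t ≤
      (∏ i ∈ e, ENNReal.ofReal (C * (min 1 (2 ^ k i * t i)) ^ (m + p⁻¹.toReal))) * lpQ d p g := by
  obtain ⟨C, hC, hmain⟩ := list_bound d m p hp
  set lam : ℝ := m + p⁻¹.toReal with hlam
  have hlam0 : 0 ≤ lam := by positivity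
  refine ⟨C * 2 ^ lam, by positivity, ?_⟩
  intro k g hg e t
  obtain ⟨hgm, hgg⟩ := Sigma_good d m k g hg
  refine iSup_le fun h => iSup_le fun hh => ?_
  have := (hmain (fun i => 2 * 2 ^ k i) (fun i => by positivity) g hgm hgg h t e.toList
    e.nodup_toList (fun i hi => (hh i (by simpa using hi)).le)).2
  have eset : (Set.univ.pi fun i => if i ∈ e.toList then Eset (m + 1) (h i) else Set.Icc 0 1) =
      cubeHE d (m + 1) h e := by
    ext x
    simp only [Set.mem_univ_pi, cubeHE, Set.mem_ofPred_eq, cube, Finset.mem_toList]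
    constructor
    · intro hx
      refine ⟨fun i => ?_, fun i hi => ?_⟩
      · have := hx i
        split_ifs at this with hi
        · exact this.1
        · exact this
      · have := hx i
        rw [if_pos hi] at this
        exact this.2
    · rintro ⟨h1, h2⟩ i
      split_ifs with hi
      · exact ⟨h1 i, h2 i hi⟩
      · exact h1 i
  rw [eset] at this
  refine this.trans ?_
  rw [Finset.prod_map_toList]
  unfold lpQ
  refine mul_le_mul_left ?_ _
  refine Finset.prod_le_prod' fun i hi => ENNReal.ofReal_le_ofReal ?_
  have ht : 0 ≤ t i := (abs_nonneg _).trans (hh i hi).le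
  have h0 : 0 ≤ min 1 (2 ^ k i * t i) := by positivity
  rw [mul_assoc, ← Real.mul_rpow (by norm_num) h0]
  push_cast
  gcongr
  rw [mul_min_of_nonneg _ _ (by norm_num)]
  apply min_le_min
  · norm_num
  · rw [mul_assoc]

end SparseGrid

namespace SparseGrid

/-- the one-dimensional majorant -/
def phi (ε μ x : ℝ) : ℝ := if x < 1 then x ^ ε else x ^ (-μ)

lemma phi_nonneg (ε μ x : ℝ) (hx : 0 ≤ x) : 0 ≤ phi ε μ x := by
  unfold phi; split_ifs <;> positivity

lemma phi_le_one (ε μ x : ℝ) (hε : 0 < ε) (hμ : 0 < μ) (hx : 0 ≤ x) : phi ε μ x ≤ 1 := by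
  unfold phi; split_ifs with h
  · exact Real.rpow_le_one hx h.le hε.le
  · exact Real.rpow_le_one_of_one_le_of_nonpos (not_lt.1 h) (by linarith)

lemma phi_measurable (ε μ : ℝ) : Measurable (phi ε μ) := by
  unfold phi
  exact Measurable.ite measurableSet_Iio (by fun_prop) (by fun_prop)

lemma phi_int (ε μ q N : ℝ) (hε : 0 < ε) (hμ : 0 < μ) (hq : 0 < q) (hN : 0 < N) :
    ∫⁻ t in Set.Icc (0:ℝ) 1, ENNReal.ofReal (phi ε μ (N * t)) ^ q * ENNReal.ofReal t⁻¹ ≤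
      ENNReal.ofReal (1 / (ε * q) + 1 / (μ * q)) := by
  have hεq : 0 < ε * q := by positivity
  have hμq : 0 < μ * q := by positivity
  set b : ℝ := N⁻¹ with hb
  have hb0 : 0 < b := by positivity
  have i1 : ∫⁻ t in Set.Ioc (0:ℝ) b,
      ENNReal.ofReal (phi ε μ (N * t)) ^ q * ENNReal.ofReal t⁻¹ ≤ ENNReal.ofReal (1 / (ε * q)) := by
    have e1 : ∫ t in Set.Ioc (0:ℝ) b, N ^ (ε * q) * t ^ (ε * q - 1) = 1 / (ε * q) := by
      rw [← intervalIntegral.integral_of_le hb0.le, intervalIntegral.integral_const_mul,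
        integral_rpow (Or.inl (by linarith)), sub_add_cancel, Real.zero_rpow hεq.ne', sub_zero,
        hb, Real.inv_rpow hN.le]
      have := Real.rpow_pos_of_pos hN (ε * q)
      field_simp
    have int1 : IntegrableOn (fun t : ℝ => N ^ (ε * q) * t ^ (ε * q - 1)) (Set.Ioc 0 b) := by
      have := (intervalIntegral.intervalIntegrable_rpow' (a := 0) (b := b)
        (r := ε * q - 1) (by linarith)).const_mul (N ^ (ε * q))
      rwa [intervalIntegrable_iff_integrableOn_Ioc_of_le hb0.le] at this
    rw [← e1, ofReal_integral_eq_lintegral_ofReal int1]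
    · refine setLIntegral_mono' measurableSet_Ioc fun t ht => ?_
      have ht0 := ht.1
      have hNt : 0 < N * t := by positivity
      rw [ENNReal.ofReal_rpow_of_nonneg (phi_nonneg _ _ _ hNt.le) hq.le,
        ← ENNReal.ofReal_mul (Real.rpow_nonneg (phi_nonneg _ _ _ hNt.le) _)]
      apply ENNReal.ofReal_le_ofReal
      have hp : phi ε μ (N * t) ≤ (N * t) ^ ε := by
        unfold phi; split_ifs with h
        · exact le_rfl
        · exact (Real.rpow_le_one_of_one_le_of_nonpos (not_lt.1 h) (by linarith)).trans
            (Real.one_le_rpow (not_lt.1 h) hε.le)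
      calc phi ε μ (N * t) ^ q * t⁻¹ ≤ ((N * t) ^ ε) ^ q * t⁻¹ := by
            gcongr
            exact phi_nonneg _ _ _ hNt.le
        _ = N ^ (ε * q) * t ^ (ε * q - 1) := by
            rw [← Real.rpow_mul hNt.le, Real.mul_rpow hN.le ht0.le, Real.rpow_sub_one ht0.ne']
            ring
    · filter_upwards [ae_restrict_mem measurableSet_Ioc] with t ht
      have ht0 := ht.1
      show 0 ≤ N ^ (ε * q) * t ^ (ε * q - 1)
      positivity
  have i2 : ∫⁻ t in Set.Ioi b,
      ENNReal.ofReal (phi ε μ (N * t)) ^ q * ENNReal.ofReal t⁻¹ ≤ ENNReal.ofReal (1 / (μ * q)) := by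
    have e1 : ∫ t in Set.Ioi b, N ^ (-(μ * q)) * t ^ (-(μ * q) - 1) = 1 / (μ * q) := by
      rw [integral_const_mul, integral_Ioi_rpow_of_lt (by linarith) hb0, sub_add_cancel, hb,
        Real.inv_rpow hN.le]
      have := Real.rpow_pos_of_pos hN (-(μ * q))
      field_simp
    have int1 : IntegrableOn (fun t : ℝ => N ^ (-(μ * q)) * t ^ (-(μ * q) - 1)) (Set.Ioi b) :=
      (integrableOn_Ioi_rpow_of_lt (by linarith) hb0).const_mul _
    rw [← e1, ofReal_integral_eq_lintegral_ofReal int1]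
    · refine setLIntegral_mono' measurableSet_Ioi fun t ht => ?_
      have ht0 : 0 < t := hb0.trans ht
      have hNt : 0 < N * t := by positivity
      have h1 : 1 ≤ N * t := by
        have : N * b ≤ N * t := mul_le_mul_of_nonneg_left (le_of_lt ht) hN.le
        rwa [hb, mul_inv_cancel₀ hN.ne'] at this
      rw [ENNReal.ofReal_rpow_of_nonneg (phi_nonneg _ _ _ hNt.le) hq.le,
        ← ENNReal.ofReal_mul (Real.rpow_nonneg (phi_nonneg _ _ _ hNt.le) _)]
      apply ENNReal.ofReal_le_ofReal
      rw [phi, if_neg (not_lt.2 h1), ← Real.rpow_mul hNt.le, Real.mul_rpow hN.le ht0.le,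
        Real.rpow_sub_one ht0.ne', neg_mul]
      apply le_of_eq; ring
    · filter_upwards [ae_restrict_mem measurableSet_Ioi] with t ht
      have ht0 : 0 < t := hb0.trans ht
      show 0 ≤ N ^ (-(μ * q)) * t ^ (-(μ * q) - 1)
      positivity
  rw [← restrict_Ioc_eq_restrict_Icc, ENNReal.ofReal_add (by positivity) (by positivity)]
  refine (lintegral_mono_set (t := Set.Ioc 0 b ∪ Set.Ioi b) ?_).trans
    ((lintegral_union_le _ _ _).trans (add_le_add i1 i2))
  intro t ht
  rcases le_or_gt t b with h | h
  · exact Or.inl ⟨ht.1, h⟩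
  · exact Or.inr h

lemma prod_int (d : ℕ) (f : Fin d → ℝ → ℝ≥0∞) (hf : ∀ i, Measurable (f i)) (K : ℝ≥0∞)
    (hK : ∀ i, ∫⁻ t in Set.Icc (0:ℝ) 1, f i t ≤ K) (e : Finset (Fin d)) :
    ∫⁻ t in cube d, ∏ i ∈ e, f i (t i) ≤ K ^ e.card := by
  have hmeas : ∀ e : Finset (Fin d), Measurable (fun t : Fin d → ℝ => ∏ i ∈ e, f i (t i)) :=
    fun e => Finset.measurable_prod _ fun i _ => (hf i).comp (measurable_pi_apply i)
  induction e using Finset.induction_on with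
  | empty =>
    simp only [Finset.prod_empty, lintegral_const, Measure.restrict_apply_univ, one_mul,
      Finset.card_empty, pow_zero]
    rw [cube, volume_pi, Measure.pi_pi]
    simp
  | insert i e hi ih =>
    have key := slice_le d i (fun _ => Set.Icc (0:ℝ) 1) (fun _ => measurableSet_Icc)
      (Set.Icc 0 1) measurableSet_Icc _ _ (hmeas (insert i e)) (hmeas e) K (by
        intro x
        have h1 : ∀ y : ℝ, ∏ j ∈ e, f j (Function.update x i y j) = ∏ j ∈ e, f j (x j) := by
          intro y
          refine Finset.prod_congr rfl fun j hj => ?_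
          have hji : j ≠ i := by rintro rfl; exact hi hj
          rw [Function.update_of_ne hji]
        simp only [Finset.prod_insert hi, h1, Function.update_self]
        rw [lintegral_mul_const _ (hf i)]
        simp only [lintegral_const, Measure.restrict_apply_univ, Real.volume_Icc, sub_zero,
          ENNReal.ofReal_one, mul_one]
        exact mul_le_mul_left (hK i) _)
    rw [Function.update_eq_self_iff.2 rfl] at key
    rw [Finset.card_insert_of_notMem hi, pow_succ']
    exact key.trans (mul_le_mul_right ih _)

lemma omega_pt (d : ℕ) (μ ρ lam : ℝ) (Ω : (Fin d → ℝ) → ℝ) (hμ : 0 < μ)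
    (hI : ∀ t : Fin d → ℝ, (∀ i, 0 < t i) → 0 < Ω t)
    (C₁ C₂ : ℝ) (hC₁ : 0 < C₁) (hC₂ : 0 < C₂)
    (ha : ∀ t t' : Fin d → ℝ, t ∈ cube d → t' ∈ cube d →
      (∀ i, 0 < t i) → (∀ i, t i ≤ t' i) →
      Ω t * ∏ i, t i ^ (-μ) ≤ C₁ * (Ω t' * ∏ i, t' i ^ (-μ)))
    (hb : ∀ t t' : Fin d → ℝ, t ∈ cube d → t' ∈ cube d →
      (∀ i, 0 < t i) → (∀ i, t i ≤ t' i) →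
      Ω t * ∏ i, t i ^ (-ρ) ≥ C₂ * (Ω t' * ∏ i, t' i ^ (-ρ)))
    (k : Fin d → ℕ) (e : Finset (Fin d)) (t : Fin d → ℝ) (ht : t ∈ cube d)
    (hpos : ∀ i ∈ e, 0 < t i) :
    Ω (dyadic d k) * ∏ i ∈ e, (min 1 (2 ^ k i * t i)) ^ lam ≤
      C₁ / C₂ * Ω (tE d e t) * ∏ i ∈ e, phi (lam - ρ) μ (2 ^ k i * t i) := by
  set a := dyadic d k with ha_def
  set T := tE d e t with hT
  have ha0 : ∀ i, 0 < a i := fun i => by simp only [ha_def, dyadic]; positivity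
  have ha1 : ∀ i, a i ≤ 1 := fun i => by
    simp only [ha_def, dyadic]
    exact inv_le_one_of_one_le₀ (one_le_pow₀ (by norm_num))
  have hT0 : ∀ i, 0 < T i := fun i => by
    simp only [hT, tE]; split_ifs with h
    · exact hpos i h
    · norm_num
  have hT1 : ∀ i, T i ≤ 1 := fun i => by
    simp only [hT, tE]; split_ifs with h
    · exact (ht i trivial).2
    · exact le_rfl
  set u : Fin d → ℝ := fun i => min (T i) (a i) with hu
  have hu0 : ∀ i, 0 < u i := fun i => lt_min (hT0 i) (ha0 i)
  have mem : ∀ v : Fin d → ℝ, (∀ i, 0 < v i) → (∀ i, v i ≤ 1) → v ∈ cube d :=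
    fun v h0 h1 i _ => ⟨(h0 i).le, h1 i⟩
  have hu1 : ∀ i, u i ≤ 1 := fun i => (min_le_left _ _).trans (hT1 i)
  have A := ha u T (mem _ hu0 hu1) (mem _ hT0 hT1) hu0 (fun i => min_le_left _ _)
  have B := hb u a (mem _ hu0 hu1) (mem _ ha0 ha1) hu0 (fun i => min_le_right _ _)
  have pp : ∀ (v : Fin d → ℝ) (s : ℝ), (∀ i, 0 < v i) → 0 < ∏ i, v i ^ s :=
    fun v s h => Finset.prod_pos fun i _ => Real.rpow_pos_of_pos (h i) _
  have inv : ∀ (v : Fin d → ℝ) (s : ℝ), (∀ i, 0 < v i) →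
      (∏ i, v i ^ s) * ∏ i, v i ^ (-s) = 1 := by
    intro v s h
    rw [← Finset.prod_mul_distrib]
    refine Finset.prod_eq_one fun i _ => ?_
    rw [← Real.rpow_add (h i), add_neg_cancel, Real.rpow_zero]
  have hΩT := hI T hT0
  -- main chain
  have chain : Ω a ≤ C₁ / C₂ * Ω T *
      ∏ i, (a i ^ ρ * u i ^ (-ρ) * (u i ^ μ * T i ^ (-μ))) := by
    rw [Finset.prod_mul_distrib, Finset.prod_mul_distrib, Finset.prod_mul_distrib]
    have h1 : Ω u ≤ C₁ * Ω T * ((∏ i, u i ^ μ) * ∏ i, T i ^ (-μ)) := by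
      have := mul_le_mul_of_nonneg_left A (pp u μ hu0).le
      calc Ω u = (∏ i, u i ^ μ) * (Ω u * ∏ i, u i ^ (-μ)) := by
            rw [mul_left_comm, inv u μ hu0, mul_one]
        _ ≤ _ := this
        _ = _ := by ring
    have h2 : C₂ * Ω a ≤ Ω u * ((∏ i, a i ^ ρ) * ∏ i, u i ^ (-ρ)) := by
      have := mul_le_mul_of_nonneg_left B (pp a ρ ha0).le
      calc C₂ * Ω a = (∏ i, a i ^ ρ) * (C₂ * (Ω a * ∏ i, a i ^ (-ρ))) := by
            rw [mul_left_comm, mul_left_comm _ (Ω a), inv a ρ ha0, mul_one]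
        _ ≤ _ := this
        _ = _ := by ring
    have h3 := mul_le_mul_of_nonneg_right h1
      (mul_pos (pp a ρ ha0) (pp u (-ρ) hu0)).le
    rw [div_mul_eq_mul_div, div_mul_eq_mul_div, le_div_iff₀ hC₂, mul_comm (Ω a)]
    refine (h2.trans h3).trans (le_of_eq ?_)
    ring
  have hm0 : ∀ i, 0 ≤ (min 1 (2 ^ k i * t i)) ^ lam := fun i => by
    have := (ht i trivial).1
    positivity
  refine (mul_le_mul_of_nonneg_right chain (Finset.prod_nonneg fun i _ => hm0 i)).trans ?_
  rw [mul_assoc]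
  refine mul_le_mul_of_nonneg_left ?_ (by positivity)
  have ite1 : ∀ f : Fin d → ℝ, ∏ i ∈ e, f i = ∏ i, if i ∈ e then f i else 1 := by
    intro f
    rw [Finset.prod_ite_mem, Finset.univ_inter]
  rw [ite1, ite1, ← Finset.prod_mul_distrib]
  refine Finset.prod_le_prod (fun i _ => ?_) (fun i _ => ?_)
  · have h1 := Real.rpow_pos_of_pos (ha0 i) ρ
    have h2 := Real.rpow_pos_of_pos (hu0 i) (-ρ)
    have h3 := Real.rpow_pos_of_pos (hu0 i) μ
    have h4 := Real.rpow_pos_of_pos (hT0 i) (-μ)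
    refine mul_nonneg (by positivity) ?_
    split_ifs
    · exact hm0 i
    · norm_num
  · have hN : 0 < (2:ℝ) ^ k i := by positivity
    have hai : a i = ((2:ℝ) ^ k i)⁻¹ := rfl
    by_cases hi : i ∈ e
    · rw [if_pos hi, if_pos hi]
      have hTi : T i = t i := by simp [hT, tE, hi]
      have hti := hpos i hi
      have hx : (2:ℝ) ^ k i * t i = t i / a i := by rw [hai]; field_simp
      rw [hx]
      by_cases hlt : t i / a i < 1
      · have hlt' : t i < a i := (div_lt_one (ha0 i)).1 hlt
        have hui : u i = t i := by simp only [hu, hTi]; exact min_eq_left hlt'.le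
        rw [hui, hTi, phi, if_pos hlt, min_eq_right hlt.le, Real.rpow_sub (div_pos hti (ha0 i)),
          Real.div_rpow hti.le (ha0 i).le ρ, Real.rpow_neg hti.le, Real.rpow_neg hti.le]
        have h1 := Real.rpow_pos_of_pos (ha0 i) ρ
        have h2 := Real.rpow_pos_of_pos hti ρ
        have h3 := Real.rpow_pos_of_pos hti μ
        apply le_of_eq
        field_simp
      · have hge : a i ≤ t i := (one_le_div (ha0 i)).1 (not_lt.1 hlt)
        have hui : u i = a i := by simp only [hu, hTi]; exact min_eq_right hge
        rw [hui, hTi, phi, if_neg hlt, min_eq_left (not_lt.1 hlt), Real.one_rpow, mul_one,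
          Real.div_rpow hti.le (ha0 i).le, Real.rpow_neg hti.le, Real.rpow_neg (ha0 i).le,
          Real.rpow_neg (ha0 i).le]
        have h1 := Real.rpow_pos_of_pos (ha0 i) ρ
        have h2 := Real.rpow_pos_of_pos (ha0 i) μ
        have h3 := Real.rpow_pos_of_pos hti μ
        apply le_of_eq
        field_simp
    · rw [if_neg hi, if_neg hi, mul_one]
      have hTi : T i = 1 := by simp [hT, tE, hi]
      have hui : u i = a i := by simp only [hu, hTi]; exact min_eq_right (ha1 i)
      rw [hui, hTi, Real.one_rpow, mul_one, ← Real.rpow_add (ha0 i), add_neg_cancel,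
        Real.rpow_zero, one_mul]
      exact Real.rpow_le_one (ha0 i).le (ha1 i) hμ.le

lemma modulus_zero (d r : ℕ) (e : Finset (Fin d)) (p : ℝ≥0∞) (f : (Fin d → ℝ) → ℝ)
    (t : Fin d → ℝ) (i : Fin d) (hi : i ∈ e) (ht : t i ≤ 0) : modulus d r e p f t = 0 := by
  unfold modulus
  simp only [ENNReal.iSup_eq_zero]
  intro h hh
  exact absurd ((abs_nonneg _).trans_lt (hh i hi)) (not_lt.2 ht)

lemma ratio_bound (d m : ℕ) (p : ℝ≥0∞) (hp : 0 < p) (μ ρ : ℝ) (Ω : (Fin d → ℝ) → ℝ)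
    (hμ : 0 < μ)
    (hI : ∀ t : Fin d → ℝ, (∀ i, 0 < t i) → 0 < Ω t)
    (C₁ C₂ : ℝ) (hC₁ : 0 < C₁) (hC₂ : 0 < C₂)
    (ha : ∀ t t' : Fin d → ℝ, t ∈ cube d → t' ∈ cube d →
      (∀ i, 0 < t i) → (∀ i, t i ≤ t' i) →
      Ω t * ∏ i, t i ^ (-μ) ≤ C₁ * (Ω t' * ∏ i, t' i ^ (-μ)))
    (hb : ∀ t t' : Fin d → ℝ, t ∈ cube d → t' ∈ cube d →
      (∀ i, 0 < t i) → (∀ i, t i ≤ t' i) →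
      Ω t * ∏ i, t i ^ (-ρ) ≥ C₂ * (Ω t' * ∏ i, t' i ^ (-ρ))) :
    ∃ C > (0:ℝ), ∀ (k : Fin d → ℕ), ∀ g ∈ SigmaRd d (m + 1) k, ∀ e : Finset (Fin d),
    ∀ t ∈ cube d,
    modulus d (m + 1) e p g t / ENNReal.ofReal (Ω (tE d e t)) ≤
      ENNReal.ofReal C * (lpQ d p g / ENNReal.ofReal (Ω (dyadic d k))) *
      ∏ i ∈ e, ENNReal.ofReal (phi (m + p⁻¹.toReal - ρ) μ (2 ^ k i * t i)) := by
  obtain ⟨C, hC, hmod⟩ := modulus_bound d m p hp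
  set lam : ℝ := m + p⁻¹.toReal with hlam
  refine ⟨(max 1 C) ^ d * (C₁ / C₂), by positivity, ?_⟩
  intro k g hg e t ht
  by_cases hz : ∃ i ∈ e, t i ≤ 0
  · obtain ⟨i, hi, hti⟩ := hz
    rw [modulus_zero d _ e p g t i hi hti, ENNReal.zero_div]
    exact zero_le
  · push Not at hz
    have hpt := omega_pt d μ ρ lam Ω hμ hI C₁ C₂ hC₁ hC₂ ha hb k e t ht hz
    have hA : 0 < Ω (dyadic d k) := hI _ fun i => by simp only [dyadic]; positivity
    have hB : 0 < Ω (tE d e t) := hI _ fun i => by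
      simp only [tE]; split_ifs with h
      · exact hz i h
      · norm_num
    have hx : ∀ i, 0 ≤ 2 ^ k i * t i := fun i => mul_nonneg (by positivity) (ht i trivial).1
    have hm := hmod k g hg e t
    have hm0 : ∀ i, 0 ≤ (min 1 (2 ^ k i * t i)) ^ lam := fun i => by
      have := hx i
      positivity
    rw [← ENNReal.ofReal_prod_of_nonneg (fun i _ => mul_nonneg hC.le (hm0 i)),
      Finset.prod_mul_distrib, Finset.prod_const] at hm
    rw [← ENNReal.ofReal_prod_of_nonneg (fun i _ => phi_nonneg _ _ _ (hx i))]
    set P := ∏ i ∈ e, (min 1 (2 ^ k i * t i)) ^ lam with hP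
    set Φ := ∏ i ∈ e, phi (lam - ρ) μ (2 ^ k i * t i) with hΦ
    have hP0 : 0 ≤ P := Finset.prod_nonneg fun i _ => hm0 i
    have hΦ0 : 0 ≤ Φ := Finset.prod_nonneg fun i _ => phi_nonneg _ _ _ (hx i)
    have hCd : C ^ e.card ≤ (max 1 C) ^ d := by
      calc C ^ e.card ≤ (max 1 C) ^ e.card := pow_le_pow_left₀ hC.le (le_max_right _ _) _
        _ ≤ _ := pow_le_pow_right₀ (le_max_left _ _) (by simpa using Finset.card_le_univ e)
    have hreal : C ^ e.card * P ≤
        (max 1 C) ^ d * (C₁ / C₂) * (Ω (dyadic d k))⁻¹ * Φ * Ω (tE d e t) := by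
      have h1 : P ≤ (C₁ / C₂) * (Ω (dyadic d k))⁻¹ * Φ * Ω (tE d e t) := by
        calc P = (Ω (dyadic d k))⁻¹ * (Ω (dyadic d k) * P) := by
              rw [inv_mul_cancel_left₀ hA.ne']
          _ ≤ (Ω (dyadic d k))⁻¹ * (C₁ / C₂ * Ω (tE d e t) * Φ) :=
              mul_le_mul_of_nonneg_left hpt (by positivity)
          _ = _ := by ring
      calc C ^ e.card * P ≤ (max 1 C) ^ d * P := mul_le_mul_of_nonneg_right hCd hP0
        _ ≤ (max 1 C) ^ d * ((C₁ / C₂) * (Ω (dyadic d k))⁻¹ * Φ * Ω (tE d e t)) :=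
            mul_le_mul_of_nonneg_left h1 (by positivity)
        _ = _ := by ring
    rw [ENNReal.div_le_iff (by simpa using hB) ENNReal.ofReal_ne_top]
    refine hm.trans ?_
    refine (mul_le_mul_left (ENNReal.ofReal_le_ofReal hreal) _).trans (le_of_eq ?_)
    rw [ENNReal.ofReal_mul (by positivity), ENNReal.ofReal_mul (by positivity),
      ENNReal.ofReal_mul (by positivity), ENNReal.ofReal_inv_of_pos hA,
      div_eq_mul_inv (lpQ d p g)]
    ring

lemma semi_bound (d m : ℕ) (p θ : ℝ≥0∞) (hp : 0 < p) (hθ : 0 < θ) (μ ρ : ℝ)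
    (Ω : (Fin d → ℝ) → ℝ) (hμ : 0 < μ) (hρ : ρ < m + p⁻¹.toReal)
    (hI : ∀ t : Fin d → ℝ, (∀ i, 0 < t i) → 0 < Ω t)
    (C₁ C₂ : ℝ) (hC₁ : 0 < C₁) (hC₂ : 0 < C₂)
    (ha : ∀ t t' : Fin d → ℝ, t ∈ cube d → t' ∈ cube d →
      (∀ i, 0 < t i) → (∀ i, t i ≤ t' i) →
      Ω t * ∏ i, t i ^ (-μ) ≤ C₁ * (Ω t' * ∏ i, t' i ^ (-μ)))
    (hb : ∀ t t' : Fin d → ℝ, t ∈ cube d → t' ∈ cube d →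
      (∀ i, 0 < t i) → (∀ i, t i ≤ t' i) →
      Ω t * ∏ i, t i ^ (-ρ) ≥ C₂ * (Ω t' * ∏ i, t' i ^ (-ρ))) (e : Finset (Fin d)) :
    ∃ C > (0:ℝ), ∀ (k : Fin d → ℕ), ∀ g ∈ SigmaRd d (m + 1) k,
    besovSemi d (m + 1) p θ Ω e g ≤
      ENNReal.ofReal C * (lpQ d p g / ENNReal.ofReal (Ω (dyadic d k))) := by
  obtain ⟨C, hC, hrat⟩ := ratio_bound d m p hp μ ρ Ω hμ hI C₁ C₂ hC₁ hC₂ ha hb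
  set ε : ℝ := m + p⁻¹.toReal - ρ with hε
  have hε0 : 0 < ε := by linarith
  by_cases htop : θ = ∞
  · refine ⟨C, hC, fun k g hg => ?_⟩
    rw [besovSemi, if_pos htop]
    refine iSup_le fun t => iSup_le fun ht => (hrat k g hg e t ht).trans ?_
    refine (mul_le_mul_right (Finset.prod_le_one' fun i _ => ?_) _).trans (mul_one _).le
    rw [ENNReal.ofReal_le_one]
    exact phi_le_one _ _ _ hε0 hμ (mul_nonneg (by positivity) (ht i trivial).1)
  · have hq : 0 < θ.toReal := ENNReal.toReal_pos hθ.ne' htop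
    set q := θ.toReal with hq_def
    set K : ℝ := 1 / (ε * q) + 1 / (μ * q) with hK
    have hK0 : 0 < K := by positivity
    refine ⟨C * (K ^ e.card) ^ (1 / q), by positivity, fun k g hg => ?_⟩
    rw [besovSemi, if_neg htop]
    set Y := ENNReal.ofReal C * (lpQ d p g / ENNReal.ofReal (Ω (dyadic d k))) with hY
    have hmf : ∀ i, Measurable (fun y : ℝ => ENNReal.ofReal (phi ε μ (2 ^ k i * y)) ^ q *
        ENNReal.ofReal y⁻¹) := fun i =>
      (((phi_measurable ε μ).comp (measurable_const_mul _)).ennreal_ofReal.pow_const q).mul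
        measurable_inv.ennreal_ofReal
    have hbound : ∫⁻ t in cube d, (modulus d (m + 1) e p g t /
          ENNReal.ofReal (Ω (tE d e t))) ^ q * ∏ i ∈ e, ENNReal.ofReal (t i)⁻¹ ≤
        Y ^ q * ENNReal.ofReal K ^ e.card := by
      calc _ ≤ ∫⁻ t in cube d, Y ^ q * ∏ i ∈ e, (ENNReal.ofReal (phi ε μ (2 ^ k i * t i)) ^ q *
              ENNReal.ofReal (t i)⁻¹) := by
            refine setLIntegral_mono' (MeasurableSet.univ_pi fun _ => measurableSet_Icc)
              fun t ht => ?_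
            rw [Finset.prod_mul_distrib, ENNReal.prod_rpow_of_nonneg hq.le, ← mul_assoc,
              ← ENNReal.mul_rpow_of_nonneg _ _ hq.le]
            exact mul_le_mul_left (ENNReal.rpow_le_rpow (hrat k g hg e t ht) hq.le) _
        _ = Y ^ q * ∫⁻ t in cube d, ∏ i ∈ e, (ENNReal.ofReal (phi ε μ (2 ^ k i * t i)) ^ q *
              ENNReal.ofReal (t i)⁻¹) := by
            rw [lintegral_const_mul]
            exact Finset.measurable_prod _ fun i _ => (hmf i).comp (measurable_pi_apply i)
        _ ≤ _ := mul_le_mul_right (prod_int d (fun i y =>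
              ENNReal.ofReal (phi ε μ (2 ^ k i * y)) ^ q * ENNReal.ofReal y⁻¹) hmf _
              (fun i => phi_int ε μ q _ hε0 hμ hq (by positivity)) e) _
    refine (ENNReal.rpow_le_rpow hbound (by positivity)).trans (le_of_eq ?_)
    rw [ENNReal.mul_rpow_of_nonneg _ _ (by positivity), ← ENNReal.rpow_mul,
      mul_one_div_cancel hq.ne', ENNReal.rpow_one, ENNReal.ofReal_mul hC.le,
      ← ENNReal.ofReal_rpow_of_nonneg (by positivity) (by positivity),
      ENNReal.ofReal_pow hK0.le, hY]
    ring

end SparseGrid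

open SparseGrid MeasureTheory in
/-- Bernstein-type inequality: under conditions (I)–(III), (a),(b) with
`μ > 0`, `ρ < min(r, r-1+1/p)`, one has `‖g‖_{B^Ω_{p,θ}} ≤ C ‖g‖_p / Ω(2^{-k})` for every
`k ∈ ℤ_+^d` and every `g ∈ Σ_r^d(k)`. -/
theorem statement6 (d r : ℕ) (hd : 0 < d) (hr : 0 < r)
    (p θ : ℝ≥0∞) (hp : 0 < p) (hθ : 0 < θ)
    (μ ρ : ℝ) (Ω : (Fin d → ℝ) → ℝ)
    -- condition (I)
    (hI : ∀ t : Fin d → ℝ, (∀ i, 0 < t i) → 0 < Ω t)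
    -- condition (II)
    (hII : ∃ C > (0:ℝ), ∀ t t' : Fin d → ℝ, (∀ i, 0 ≤ t i) → (∀ i, t i ≤ t' i) →
      Ω t ≤ C * Ω t')
    -- condition (III)
    (hIII : ∀ γ : Fin d → ℝ, (∀ i, 1 ≤ γ i) → ∃ C' > (0:ℝ),
      ∀ lamv : Fin d → ℝ, (∀ i, 0 ≤ lamv i) → (∀ i, lamv i ≤ γ i) →
      ∀ t : Fin d → ℝ, (∀ i, 0 ≤ t i) → Ω (fun i => lamv i * t i) ≤ C' * Ω t)
    -- `μ > 0` and `ρ < min(r, r-1+1/p)`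
    (hμ : 0 < μ) (hρ : ρ < min (r : ℝ) ((r : ℝ) - 1 + p⁻¹.toReal))
    -- condition (a)
    (ha : ∃ C₁ > (0:ℝ), ∀ t t' : Fin d → ℝ, t ∈ cube d → t' ∈ cube d →
      (∀ i, 0 < t i) → (∀ i, t i ≤ t' i) →
      Ω t * ∏ i, t i ^ (-μ) ≤ C₁ * (Ω t' * ∏ i, t' i ^ (-μ)))
    -- condition (b)
    (hb : ∃ C₂ > (0:ℝ), ∀ t t' : Fin d → ℝ, t ∈ cube d → t' ∈ cube d →
      (∀ i, 0 < t i) → (∀ i, t i ≤ t' i) →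
      Ω t * ∏ i, t i ^ (-ρ) ≥ C₂ * (Ω t' * ∏ i, t' i ^ (-ρ))) :
    ∃ C > (0:ℝ), ∀ k : Fin d → ℕ, ∀ g ∈ SigmaRd d r k,
      besovNorm d r p θ Ω g ≤
        ENNReal.ofReal C * (lpQ d p g / ENNReal.ofReal (Ω (dyadic d k))) := by
  obtain ⟨m, rfl⟩ : ∃ m, r = m + 1 := ⟨r - 1, by omega⟩
  obtain ⟨C₁, hC₁, ha⟩ := ha
  obtain ⟨C₂, hC₂, hb⟩ := hb
  have hρ' : ρ < m + p⁻¹.toReal := by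
    have := hρ.trans_le (min_le_right _ _)
    push_cast at this
    linarith
  choose C hC hmain using
    semi_bound d m p θ hp hθ μ ρ Ω hμ hρ' hI C₁ C₂ hC₁ hC₂ ha hb
  refine ⟨∑ e, C e, Finset.sum_pos (fun e _ => hC e) Finset.univ_nonempty, fun k g hg => ?_⟩
  unfold besovNorm
  rw [ENNReal.ofReal_sum_of_nonneg fun e _ => (hC e).le, Finset.sum_mul]
  exact Finset.sum_le_sum fun e _ => hmain e k g hg
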